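/- arXiv:1610.08208 — 6 statements merged into one kernel-verified Lean document; each statement's English description precedes it below -/
import Mathlib

section
/- The n(n+2) functions φ_α (1 ≤ α ≤ n), φ_{kl} and φ_{k̄l̄} (1 ≤ k < l ≤ n+1), restricted to the unit sphere S^{2n+1} ⊂ ℂ^{n+1}, form an orthonormal system with respect to the L² inner product (f,h) = ∫_{S^{2n+1}} f·h dμ, where μ is the rotation-invariant Borel measure on S^{2n+1} normalized so that μ(S^{2n+1}) = n(n+2). That is, the integral of the product of any two distinct functions from this family is 0, and the integral of the square of each function is 1. -/
open scoped BigOperators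

/-- Pairs `k < l` of indices in `Fin m`. -/
abbrev SpherePairs (m : ℕ) := {p : Fin m × Fin m // p.1 < p.2}

/-- The constant `c_{n,α}` (with `α` given 1-based). -/
noncomputable def LOc (n α : ℕ) : ℝ :=
  Real.sqrt (((n : ℝ) + 1) * ((n : ℝ) + 1 - α) / ((n : ℝ) * ((n : ℝ) + 2 - α)))

/-- The constant `d_n`. -/
noncomputable def LOd (n : ℕ) : ℝ := Real.sqrt (2 * ((n : ℝ) + 1) / n)

/-- `φ_α`, for `α : Fin n` representing the 1-based index `α+1`. -/
noncomputable def phiA (n : ℕ) (α : Fin n) (z : Fin (n + 1) → ℂ) : ℝ :=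
  LOc n (α.val + 1) *
    (Complex.normSq (z α.castSucc) -
      (1 / ((n : ℝ) - α.val)) *
        ∑ k : Fin (n + 1), if (α.val : ℕ) < k.val then Complex.normSq (z k) else 0)

/-- `φ_{kl} = d_n Re(z_k conj z_l)`, for a pair `k < l` (0-based). -/
noncomputable def phiR (n : ℕ) (p : SpherePairs (n + 1)) (z : Fin (n + 1) → ℂ) : ℝ :=
  LOd n * (z p.1.1 * (starRingEnd ℂ) (z p.1.2)).re

/-- `φ_{k̄l̄} = d_n Im(z_k conj z_l)`. -/
noncomputable def phiI (n : ℕ) (p : SpherePairs (n + 1)) (z : Fin (n + 1) → ℂ) : ℝ :=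
  LOd n * (z p.1.1 * (starRingEnd ℂ) (z p.1.2)).im

/-- Index type for the `n(n+2)` functions of Lemma 3.1. -/
abbrev FamIdx (n : ℕ) := Fin n ⊕ SpherePairs (n + 1) ⊕ SpherePairs (n + 1)

/-- The family `φ_α, φ_{kl}, φ_{k̄l̄}`. -/
noncomputable def fam (n : ℕ) : FamIdx n → (Fin (n + 1) → ℂ) → ℝ
  | Sum.inl α => phiA n α
  | Sum.inr (Sum.inl p) => phiR n p
  | Sum.inr (Sum.inr p) => phiI n p

open MeasureTheory

theorem continuous_re_mul_conj {ι : Type*} (k l : ι) :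
    Continuous fun z : ι → ℂ => (z k * (starRingEnd ℂ) (z l)).re := by
  fun_prop

theorem continuous_im_mul_conj {ι : Type*} (k l : ι) :
    Continuous fun z : ι → ℂ => (z k * (starRingEnd ℂ) (z l)).im := by
  fun_prop

theorem continuous_normSq_coord {ι : Type*} (k : ι) :
    Continuous fun z : ι → ℂ => Complex.normSq (z k) :=
  Complex.continuous_normSq.comp (continuous_apply k)

section Isometries

variable {ι : Type*} [DecidableEq ι]

/-- Multiplication of the coordinate `k` by `u`, fixing the other coordinates. -/
noncomputable def mulCoord (k : ι) (u : ℂ) : (ι → ℂ) →ₗ[ℝ] (ι → ℂ) :=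
  LinearMap.mulLeft ℝ (Pi.mulSingle k u)

theorem mulCoord_apply_self (k : ι) (u : ℂ) (z : ι → ℂ) : mulCoord k u z k = u * z k := by
  simp [mulCoord]

theorem mulCoord_apply_of_ne {k i : ι} (h : i ≠ k) (u : ℂ) (z : ι → ℂ) :
    mulCoord k u z i = z i := by
  simp [mulCoord, h]

theorem normSq_mulCoord (k : ι) {u : ℂ} (hu : Complex.normSq u = 1) (z : ι → ℂ) (i : ι) :
    Complex.normSq (mulCoord k u z i) = Complex.normSq (z i) := by
  by_cases h : i = k
  · rw [h, mulCoord_apply_self, Complex.normSq_mul, hu, one_mul]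
  · rw [mulCoord_apply_of_ne h]

/-- The real-linear isometry `(z_k, z_l) ↦ ((z_k + z_l)/√2, (z_k - z_l)/√2)`. -/
noncomputable def hadamard (k l : ι) : (ι → ℂ) →ₗ[ℝ] (ι → ℂ) where
  toFun z i := if i = k then ((√2)⁻¹ : ℝ) * (z k + z l)
    else if i = l then ((√2)⁻¹ : ℝ) * (z k - z l) else z i
  map_add' x y := by
    ext1 i
    simp only [Pi.add_apply]
    split_ifs <;> ring
  map_smul' c x := by
    ext1 i
    simp only [Pi.smul_apply, Complex.real_smul, RingHom.id_apply]
    split_ifs <;> ring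

theorem normSq_inv_sqrt_two_mul (w : ℂ) :
    Complex.normSq (((√2)⁻¹ : ℝ) * w) = Complex.normSq w / 2 := by
  rw [Complex.normSq_mul, Complex.normSq_ofReal, ← mul_inv, Real.mul_self_sqrt (by norm_num)]
  ring

end Isometries

section Moments

variable {ι : Type*} [Fintype ι] {μ : Measure (ι → ℂ)}

/-- Invariance of a measure on `ℂ^ι` under all real-linear isometries of the Hermitian norm. -/
def OrthogonalInvariant (μ : Measure (ι → ℂ)) : Prop :=
  ∀ g : (ι → ℂ) →ₗ[ℝ] (ι → ℂ),
    (∀ z, ∑ k, Complex.normSq (g z k) = ∑ k, Complex.normSq (z k)) → μ.map g = μ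

theorem OrthogonalInvariant.integral_comp (hμ : OrthogonalInvariant μ)
    (g : (ι → ℂ) →ₗ[ℝ] (ι → ℂ))
    (hg : ∀ z, ∑ k, Complex.normSq (g z k) = ∑ k, Complex.normSq (z k))
    {f : (ι → ℂ) → ℝ} (hf : Continuous f) : ∫ z, f (g z) ∂μ = ∫ z, f z ∂μ := by
  have hc : Continuous g := g.continuous_of_finiteDimensional
  conv_rhs => rw [← hμ g hg]
  exact (integral_map hc.aemeasurable hf.aestronglyMeasurable).symm

theorem OrthogonalInvariant.integral_eq_zero (hμ : OrthogonalInvariant μ)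
    (g : (ι → ℂ) →ₗ[ℝ] (ι → ℂ))
    (hg : ∀ z, ∑ k, Complex.normSq (g z k) = ∑ k, Complex.normSq (z k))
    {f : (ι → ℂ) → ℝ} (hf : Continuous f) (hodd : ∀ z, f (g z) = -f z) :
    ∫ z, f z ∂μ = 0 := by
  have h := hμ.integral_comp g hg hf
  simp only [hodd, integral_neg] at h
  linarith

/-- A continuous function that is odd under complex conjugation has integral zero. -/
theorem OrthogonalInvariant.integral_eq_zero_of_conj (hμ : OrthogonalInvariant μ)
    {f : (ι → ℂ) → ℝ} (hf : Continuous f)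
    (hodd : ∀ z, f (fun i => (starRingEnd ℂ) (z i)) = -f z) : ∫ z, f z ∂μ = 0 :=
  hμ.integral_eq_zero (Complex.conjAe.toLinearMap.compLeft ι)
    (fun z => by simp [LinearMap.compLeft, Complex.normSq_conj]) hf hodd

theorem integrable_of_continuous_of_sphere [IsFiniteMeasure μ]
    (hsph : ∀ᵐ z ∂μ, ∑ k, Complex.normSq (z k) = 1)
    {f : (ι → ℂ) → ℝ} (hf : Continuous f) : Integrable f μ := by
  have h := hf.continuousOn.integrableOn_compact (μ := μ)
    (isCompact_closedBall (0 : ι → ℂ) 1)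
  rwa [IntegrableOn, Measure.restrict_eq_self_of_ae_mem] at h
  filter_upwards [hsph] with z hz
  rw [mem_closedBall_zero_iff, pi_norm_le_iff_of_nonneg zero_le_one]
  intro i
  have h1 : Complex.normSq (z i) ≤ 1 := hz ▸ Finset.single_le_sum
    (f := fun k => Complex.normSq (z k)) (fun k _ => Complex.normSq_nonneg _) (Finset.mem_univ i)
  rw [Complex.normSq_eq_norm_sq] at h1
  exact (sq_le_one_iff₀ (norm_nonneg _)).1 h1

variable [DecidableEq ι]

theorem OrthogonalInvariant.integral_mulCoord (hμ : OrthogonalInvariant μ) (k : ι) {u : ℂ}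
    (hu : Complex.normSq u = 1) {f : (ι → ℂ) → ℝ} (hf : Continuous f) :
    ∫ z, f (mulCoord k u z) ∂μ = ∫ z, f z ∂μ :=
  hμ.integral_comp (mulCoord k u)
    (fun z => Finset.sum_congr rfl fun i _ => normSq_mulCoord k hu z i) hf

theorem OrthogonalInvariant.integral_eq_zero_of_neg_coord (hμ : OrthogonalInvariant μ) (k : ι)
    {f : (ι → ℂ) → ℝ} (hf : Continuous f) (hodd : ∀ z, f (mulCoord k (-1) z) = -f z) :
    ∫ z, f z ∂μ = 0 := by
  have h := hμ.integral_mulCoord k (u := -1) (by simp) hf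
  simp only [hodd, integral_neg] at h
  linarith

theorem sum_normSq_hadamard {k l : ι} (hkl : k ≠ l) (z : ι → ℂ) :
    ∑ i, Complex.normSq (hadamard k l z i) = ∑ i, Complex.normSq (z i) := by
  have h : ∀ i, Complex.normSq (hadamard k l z i) = Complex.normSq (z i)
      + (if i = k then Complex.normSq (z k + z l) / 2 - Complex.normSq (z k) else 0)
      + (if i = l then Complex.normSq (z k - z l) / 2 - Complex.normSq (z l) else 0) := by
    intro i
    by_cases hk : i = k
    · subst hk
      simp only [hadamard, LinearMap.coe_mk, AddHom.coe_mk, if_true, if_neg hkl,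
        normSq_inv_sqrt_two_mul]
      ring
    · by_cases hl : i = l
      · subst hl
        simp only [hadamard, LinearMap.coe_mk, AddHom.coe_mk, if_true, if_neg hk,
          normSq_inv_sqrt_two_mul]
        ring
      · simp [hadamard, hk, hl]
  simp only [h, Finset.sum_add_distrib, Finset.sum_ite_eq', Finset.mem_univ, if_true,
    Complex.normSq_apply, Complex.add_re, Complex.add_im, Complex.sub_re, Complex.sub_im]
  ring

theorem OrthogonalInvariant.integral_normSq_sq_eq (hμ : OrthogonalInvariant μ) (k l : ι) :
    ∫ z, Complex.normSq (z k) ^ 2 ∂μ = ∫ z, Complex.normSq (z l) ^ 2 ∂μ := by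
  have h := hμ.integral_comp (LinearMap.funLeft ℝ ℂ (Equiv.swap k l))
    (fun z => Equiv.sum_comp (Equiv.swap k l) fun i => Complex.normSq (z i))
    (f := fun z => Complex.normSq (z l) ^ 2)
    ((Complex.continuous_normSq.comp (continuous_apply l)).pow 2)
  simpa [LinearMap.funLeft_apply] using h

theorem OrthogonalInvariant.integral_im_sq_eq (hμ : OrthogonalInvariant μ) {k l : ι}
    (hkl : k ≠ l) : ∫ z, (z k * (starRingEnd ℂ) (z l)).im ^ 2 ∂μ =
      ∫ z, (z k * (starRingEnd ℂ) (z l)).re ^ 2 ∂μ := by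
  rw [← hμ.integral_mulCoord k (u := Complex.I) (by simp)
    (f := fun z => (z k * (starRingEnd ℂ) (z l)).re ^ 2) (by fun_prop)]
  congr 1
  ext z
  rw [mulCoord_apply_self, mulCoord_apply_of_ne hkl.symm, mul_assoc, Complex.I_mul_re, neg_sq]

theorem OrthogonalInvariant.two_mul_integral_re_sq [IsFiniteMeasure μ]
    (hμ : OrthogonalInvariant μ) (hsph : ∀ᵐ z ∂μ, ∑ k, Complex.normSq (z k) = 1)
    {k l : ι} (hkl : k ≠ l) :
    2 * ∫ z, (z k * (starRingEnd ℂ) (z l)).re ^ 2 ∂μ =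
      ∫ z, Complex.normSq (z k) * Complex.normSq (z l) ∂μ := by
  have h : ∀ z : ι → ℂ, Complex.normSq (z k) * Complex.normSq (z l) =
      (z k * (starRingEnd ℂ) (z l)).re ^ 2 + (z k * (starRingEnd ℂ) (z l)).im ^ 2 := by
    intro z
    rw [← Complex.normSq_conj (z l), ← Complex.normSq_mul, Complex.normSq_apply]
    ring
  simp_rw [h]
  rw [integral_add (integrable_of_continuous_of_sphere hsph (by fun_prop))
    (integrable_of_continuous_of_sphere hsph (by fun_prop)),
    hμ.integral_im_sq_eq hkl]
  ring

theorem OrthogonalInvariant.two_mul_integral_normSq_mul [IsFiniteMeasure μ]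
    (hμ : OrthogonalInvariant μ) (hsph : ∀ᵐ z ∂μ, ∑ k, Complex.normSq (z k) = 1)
    {k l : ι} (hkl : k ≠ l) :
    2 * ∫ z, Complex.normSq (z k) * Complex.normSq (z l) ∂μ =
      ∫ z, Complex.normSq (z k) ^ 2 ∂μ := by
  have hint : ∀ {f : (ι → ℂ) → ℝ}, Continuous f → Integrable f μ :=
    integrable_of_continuous_of_sphere hsph
  have hck := continuous_normSq_coord k
  have hcl := continuous_normSq_coord l
  have h := hμ.integral_comp (hadamard k l) (sum_normSq_hadamard hkl)
    (f := fun z => Complex.normSq (z k) * Complex.normSq (z l)) (hck.mul hcl)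
  have hrot : ∀ z : ι → ℂ,
      Complex.normSq (hadamard k l z k) * Complex.normSq (hadamard k l z l) =
        (1 / 4 * Complex.normSq (z k) ^ 2 + 1 / 4 * Complex.normSq (z l) ^ 2
          + 1 / 2 * (Complex.normSq (z k) * Complex.normSq (z l)))
        - (z k * (starRingEnd ℂ) (z l)).re ^ 2 := by
    intro z
    simp only [hadamard, LinearMap.coe_mk, AddHom.coe_mk, if_true, if_neg hkl.symm,
      normSq_inv_sqrt_two_mul]
    simp only [Complex.normSq_apply, Complex.add_re, Complex.add_im, Complex.sub_re,
      Complex.sub_im, Complex.mul_re, Complex.conj_re, Complex.conj_im]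
    ring
  simp_rw [hrot] at h
  rw [integral_sub (hint (by fun_prop)) (hint (by fun_prop)),
    integral_add (hint (by fun_prop)) (hint (by fun_prop)),
    integral_add (hint (by fun_prop)) (hint (by fun_prop)),
    integral_const_mul, integral_const_mul, integral_const_mul,
    hμ.integral_normSq_sq_eq l k] at h
  linarith [hμ.two_mul_integral_re_sq hsph hkl]

/-- The fourth moments of the moduli of the coordinates. -/
theorem OrthogonalInvariant.integral_normSq_mul [IsFiniteMeasure μ]
    (hμ : OrthogonalInvariant μ) (hsph : ∀ᵐ z ∂μ, ∑ k, Complex.normSq (z k) = 1) (k l : ι) :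
    ∫ z, Complex.normSq (z k) * Complex.normSq (z l) ∂μ =
      μ.real Set.univ / (Fintype.card ι * (Fintype.card ι + 1)) * (1 + if k = l then 1 else 0) := by
  set a := ∫ z, Complex.normSq (z k) ^ 2 ∂μ with ha
  have hmom : ∀ i j, ∫ z, Complex.normSq (z i) * Complex.normSq (z j) ∂μ =
      a / 2 * (1 + if i = j then 1 else 0) := by
    intro i j
    by_cases hij : i = j
    · subst hij
      simp only [if_true, ← pow_two]
      rw [hμ.integral_normSq_sq_eq i k]
      ring
    · have h := hμ.two_mul_integral_normSq_mul hsph hij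
      rw [hμ.integral_normSq_sq_eq i k] at h
      rw [if_neg hij]
      linarith
  have htot : ∑ i, ∑ j, ∫ z, Complex.normSq (z i) * Complex.normSq (z j) ∂μ =
      μ.real Set.univ := by
    have hint : ∀ i j, Integrable
        (fun z : ι → ℂ => Complex.normSq (z i) * Complex.normSq (z j)) μ := fun i j =>
      integrable_of_continuous_of_sphere hsph
        ((continuous_normSq_coord i).mul (continuous_normSq_coord j))
    have h : ∀ᵐ z ∂μ, ∑ i, ∑ j, Complex.normSq (z i) * Complex.normSq (z j) = (1 : ℝ) := by
      filter_upwards [hsph] with z hz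
      rw [← Finset.sum_mul_sum, hz, one_mul]
    simp_rw [← integral_finsetSum _ fun j _ => hint _ j]
    rw [← integral_finsetSum _ fun i _ => integrable_finsetSum _ fun j _ => hint i j,
      integral_congr_ae h]
    simp
  simp only [hmom, ← Finset.mul_sum, Finset.sum_add_distrib, Finset.sum_ite_eq, Finset.mem_univ,
    if_true, Finset.sum_const, Finset.card_univ, nsmul_eq_mul, mul_one] at htot
  have hcard : (0 : ℝ) < Fintype.card ι := by
    exact_mod_cast Fintype.card_pos_iff.2 ⟨k⟩
  rw [hmom k l, ← htot]
  field_simp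

/-- Two linear combinations of the `|z_k|²`, one of them with vanishing coefficient sum. -/
theorem OrthogonalInvariant.integral_sum_mul_sum [IsFiniteMeasure μ]
    (hμ : OrthogonalInvariant μ) (hsph : ∀ᵐ z ∂μ, ∑ k, Complex.normSq (z k) = 1)
    (v w : ι → ℝ) (hv : ∑ k, v k = 0) :
    ∫ z, (∑ k, v k * Complex.normSq (z k)) * (∑ k, w k * Complex.normSq (z k)) ∂μ =
      μ.real Set.univ / (Fintype.card ι * (Fintype.card ι + 1)) * ∑ k, v k * w k := by
  have hint : ∀ i j, Integrable
      (fun z : ι → ℂ => v i * w j * (Complex.normSq (z i) * Complex.normSq (z j))) μ :=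
    fun i j => (integrable_of_continuous_of_sphere hsph
      ((continuous_normSq_coord i).mul (continuous_normSq_coord j))).const_mul _
  simp_rw [Finset.sum_mul_sum, mul_mul_mul_comm]
  rw [integral_finsetSum _ fun i _ => integrable_finsetSum _ fun j _ => hint i j]
  simp_rw [integral_finsetSum _ fun j _ => hint _ j, integral_const_mul,
    hμ.integral_normSq_mul hsph]
  set B := μ.real Set.univ / (Fintype.card ι * (Fintype.card ι + 1) : ℝ)
  have h : ∀ i j, v i * w j * (B * (1 + if i = j then (1 : ℝ) else 0)) =
      B * (v i * w j) + if i = j then B * (v i * w j) else 0 := by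
    intro i j
    split_ifs <;> ring
  simp only [h, Finset.sum_add_distrib, ← Finset.mul_sum, ← Finset.sum_mul, hv,
    Finset.sum_ite_eq, Finset.mem_univ, if_true]
  ring

end Moments

/-- The coefficients of `φ_α / c_{n,α}` as a linear combination of the `|z_k|²`. -/
noncomputable def phiCoeff (n : ℕ) (α : Fin n) (k : Fin (n + 1)) : ℝ :=
  (if k = α.castSucc then 1 else 0) - if α.val < k.val then 1 / ((n : ℝ) - α.val) else 0

theorem phiA_eq_sum (n : ℕ) (α : Fin n) (z : Fin (n + 1) → ℂ) :
    phiA n α z = LOc n (α.val + 1) * ∑ k, phiCoeff n α k * Complex.normSq (z k) := by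
  simp [phiA, phiCoeff, sub_mul, Finset.sum_sub_distrib, Finset.mul_sum, ite_mul, mul_ite]

theorem natCast_sub_fin_pos {n : ℕ} (α : Fin n) : (0 : ℝ) < (n : ℝ) - α.val := by
  have : (α.val : ℝ) < n := by exact_mod_cast α.isLt
  linarith

theorem sum_ite_castSucc_lt (n : ℕ) (α : Fin n) (c : ℝ) :
    (∑ k : Fin (n + 1), if α.val < k.val then c else 0) = ((n : ℝ) - α.val) * c := by
  have h : Finset.univ.filter (fun k : Fin (n + 1) => α.val < k.val) =
      Finset.Ioi α.castSucc := by
    ext k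
    simp [Fin.lt_def]
  rw [← Finset.sum_filter, h, Finset.sum_const, Fin.card_Ioi, nsmul_eq_mul]
  congr 1
  rw [← Nat.cast_sub α.isLt.le]
  congr 1

theorem sum_phiCoeff (n : ℕ) (α : Fin n) : ∑ k, phiCoeff n α k = 0 := by
  have h := natCast_sub_fin_pos α
  simp only [phiCoeff, Finset.sum_sub_distrib, Finset.sum_ite_eq', Finset.mem_univ, if_true,
    sum_ite_castSucc_lt]
  field_simp
  ring

theorem sum_phiCoeff_sq (n : ℕ) (α : Fin n) :
    ∑ k, phiCoeff n α k * phiCoeff n α k = ((n : ℝ) + 1 - α.val) / ((n : ℝ) - α.val) := by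
  have h := natCast_sub_fin_pos α
  have hk : ∀ k, phiCoeff n α k * phiCoeff n α k = (if k = α.castSucc then 1 else 0) +
      if α.val < k.val then (1 / ((n : ℝ) - α.val)) ^ 2 else 0 := by
    intro k
    by_cases hk : k = α.castSucc
    · simp [phiCoeff, hk]
    · simp only [phiCoeff, if_neg hk]
      split_ifs <;> ring
  simp only [hk, Finset.sum_add_distrib, Finset.sum_ite_eq', Finset.mem_univ, if_true,
    sum_ite_castSucc_lt]
  field_simp
  ring

theorem sum_phiCoeff_mul_of_lt {n : ℕ} {α β : Fin n} (hαβ : α < β) :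
    ∑ k, phiCoeff n α k * phiCoeff n β k = 0 := by
  have hk : ∀ k, phiCoeff n α k * phiCoeff n β k =
      -(1 / ((n : ℝ) - α.val)) * phiCoeff n β k := by
    intro k
    rw [Fin.lt_def] at hαβ
    by_cases hlt : α.val < k.val
    · have hne : k ≠ α.castSucc := by
        rintro rfl
        simp at hlt
      simp [phiCoeff, hlt, hne]
    · have hne : k ≠ β.castSucc := by
        rintro rfl
        simp only [Fin.val_castSucc] at hlt
        exact hlt hαβ
      have hlt' : ¬ β.val < k.val := by omega
      simp [phiCoeff, hne, hlt']
  simp only [hk, ← Finset.mul_sum, sum_phiCoeff, mul_zero]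

theorem sum_phiCoeff_mul_of_ne {n : ℕ} {α β : Fin n} (hαβ : α ≠ β) :
    ∑ k, phiCoeff n α k * phiCoeff n β k = 0 := by
  rcases lt_or_gt_of_ne hαβ with h | h
  · exact sum_phiCoeff_mul_of_lt h
  · simp_rw [mul_comm (phiCoeff n α _)]
    exact sum_phiCoeff_mul_of_lt h

theorem LOc_mul_self (n : ℕ) (α : Fin n) :
    LOc n (α.val + 1) * LOc n (α.val + 1) =
      ((n : ℝ) + 1) * ((n : ℝ) - α.val) / ((n : ℝ) * ((n : ℝ) + 1 - α.val)) := by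
  have h := natCast_sub_fin_pos α
  have h1 : (n : ℝ) + 1 - ((α.val + 1 : ℕ) : ℝ) = n - α.val := by push_cast; ring
  have h2 : (n : ℝ) + 2 - ((α.val + 1 : ℕ) : ℝ) = n + 1 - α.val := by push_cast; ring
  have h3 : (0 : ℝ) ≤ n + 1 - α.val := by linarith
  rw [LOc, h1, h2]
  exact Real.mul_self_sqrt (by positivity)

theorem LOd_mul_self (n : ℕ) : LOd n * LOd n = 2 * ((n : ℝ) + 1) / n :=
  Real.mul_self_sqrt (by positivity)

theorem continuous_phiA (n : ℕ) (α : Fin n) : Continuous (phiA n α) := by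
  simp_rw [funext (phiA_eq_sum n α)]
  exact continuous_const.mul <| continuous_finsetSum _ fun k _ =>
    continuous_const.mul (continuous_normSq_coord k)

theorem continuous_phiR (n : ℕ) (p : SpherePairs (n + 1)) : Continuous (phiR n p) :=
  continuous_const.mul (continuous_re_mul_conj _ _)

theorem continuous_phiI (n : ℕ) (p : SpherePairs (n + 1)) : Continuous (phiI n p) :=
  continuous_const.mul (continuous_im_mul_conj _ _)

theorem phiA_conj (n : ℕ) (α : Fin n) (z : Fin (n + 1) → ℂ) :
    phiA n α (fun i => (starRingEnd ℂ) (z i)) = phiA n α z := by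
  simp [phiA, Complex.normSq_conj]

theorem phiR_conj (n : ℕ) (p : SpherePairs (n + 1)) (z : Fin (n + 1) → ℂ) :
    phiR n p (fun i => (starRingEnd ℂ) (z i)) = phiR n p z := by
  simp [phiR]

theorem phiI_conj (n : ℕ) (p : SpherePairs (n + 1)) (z : Fin (n + 1) → ℂ) :
    phiI n p (fun i => (starRingEnd ℂ) (z i)) = -phiI n p z := by
  simp [phiI]
  ring

theorem phiA_neg_coord (n : ℕ) (α : Fin n) (k : Fin (n + 1)) (z : Fin (n + 1) → ℂ) :
    phiA n α (mulCoord k (-1) z) = phiA n α z := by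
  simp only [phiA, normSq_mulCoord k (u := -1) (by simp)]

theorem mul_conj_neg_coord_of_mem {m : ℕ} {p : SpherePairs m} {k : Fin m}
    (hk : k = p.1.1 ∨ k = p.1.2) (z : Fin m → ℂ) :
    mulCoord k (-1) z p.1.1 * (starRingEnd ℂ) (mulCoord k (-1) z p.1.2) =
      -(z p.1.1 * (starRingEnd ℂ) (z p.1.2)) := by
  have hp := p.2.ne
  rcases hk with rfl | rfl
  · simp [mulCoord_apply_self, mulCoord_apply_of_ne hp.symm]
  · simp [mulCoord_apply_self, mulCoord_apply_of_ne hp]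

theorem mul_conj_neg_coord_of_notMem {m : ℕ} {p : SpherePairs m} {k : Fin m}
    (hk : ¬(k = p.1.1 ∨ k = p.1.2)) (z : Fin m → ℂ) :
    mulCoord k (-1) z p.1.1 * (starRingEnd ℂ) (mulCoord k (-1) z p.1.2) =
      z p.1.1 * (starRingEnd ℂ) (z p.1.2) := by
  rw [not_or] at hk
  rw [mulCoord_apply_of_ne (Ne.symm hk.1), mulCoord_apply_of_ne (Ne.symm hk.2)]

/-- Two distinct ordered pairs differ by an index of the first one. -/
theorem SpherePairs.exists_mem_notMem {m : ℕ} {p q : SpherePairs m} (hpq : p ≠ q) :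
    ∃ k, (k = p.1.1 ∨ k = p.1.2) ∧ ¬(k = q.1.1 ∨ k = q.1.2) := by
  by_contra! h
  have h1 := h p.1.1 (Or.inl rfl)
  have h2 := h p.1.2 (Or.inr rfl)
  have hp := p.2
  have hq := q.2
  refine hpq (Subtype.ext (Prod.ext ?_ ?_)) <;>
  · simp only [Fin.lt_def, Fin.ext_iff] at *
    omega

/-- Lemma 3.1. The `n(n+2)` functions `φ_α, φ_{kl}, φ_{k̄l̄}`,
restricted to the unit sphere `S^{2n+1} ⊂ ℂ^{n+1}`, form an orthonormal system
with respect to the `L²` inner product given by the rotation-invariant Borel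
measure `μ` on the sphere normalized so that `μ(S^{2n+1}) = n(n+2)`. -/
theorem typeI_orthonormal (n : ℕ) (hn : 1 ≤ n)
    (μ : Measure (Fin (n + 1) → ℂ))
    (hsph : μ {z | ∑ k : Fin (n + 1), Complex.normSq (z k) ≠ 1} = 0)
    (hinv : ∀ g : (Fin (n + 1) → ℂ) →ₗ[ℝ] (Fin (n + 1) → ℂ),
      (∀ z, ∑ k : Fin (n + 1), Complex.normSq (g z k) =
        ∑ k : Fin (n + 1), Complex.normSq (z k)) → μ.map g = μ)
    (htot : μ Set.univ = ENNReal.ofReal (n * (n + 2))) :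
    ∀ i j : FamIdx n,
      ∫ z, fam n i z * fam n j z ∂μ = if i = j then 1 else 0 := by
  have hμ : OrthogonalInvariant μ := hinv
  have hae : ∀ᵐ z ∂μ, ∑ k, Complex.normSq (z k) = 1 := hsph
  have : IsFiniteMeasure μ := ⟨by rw [htot]; exact ENNReal.ofReal_lt_top⟩
  have hn0 : (0 : ℝ) < n := by exact_mod_cast hn
  have hB : μ.real Set.univ / (Fintype.card (Fin (n + 1)) * (Fintype.card (Fin (n + 1)) + 1)) =
      (n : ℝ) / (n + 1) := by
    rw [Measure.real, htot, ENNReal.toReal_ofReal (by positivity), Fintype.card_fin]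
    push_cast
    field_simp
    ring
  have hAA : ∀ α β, ∫ z, phiA n α z * phiA n β z ∂μ = if α = β then 1 else 0 := by
    intro α β
    simp_rw [phiA_eq_sum, mul_mul_mul_comm (LOc n _)]
    rw [integral_const_mul, hμ.integral_sum_mul_sum hae _ _ (sum_phiCoeff n α), hB]
    split_ifs with h
    · subst h
      have hα := natCast_sub_fin_pos α
      have hα' : (0 : ℝ) < n + 1 - α.val := by linarith
      rw [LOc_mul_self, sum_phiCoeff_sq]
      field_simp
    · rw [sum_phiCoeff_mul_of_ne h, mul_zero, mul_zero]
  have hAR : ∀ α p, ∫ z, phiA n α z * phiR n p z ∂μ = 0 := fun α p =>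
    hμ.integral_eq_zero_of_neg_coord p.1.1 ((continuous_phiA n α).mul (continuous_phiR n p))
      fun z => by
        rw [phiA_neg_coord, phiR, phiR, mul_conj_neg_coord_of_mem (Or.inl rfl), Complex.neg_re]
        ring
  have hAI : ∀ α p, ∫ z, phiA n α z * phiI n p z ∂μ = 0 := fun α p =>
    hμ.integral_eq_zero_of_conj ((continuous_phiA n α).mul (continuous_phiI n p))
      fun z => by rw [phiA_conj, phiI_conj, mul_neg]
  have hRI : ∀ p q, ∫ z, phiR n p z * phiI n q z ∂μ = 0 := fun p q =>
    hμ.integral_eq_zero_of_conj ((continuous_phiR n p).mul (continuous_phiI n q))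
      fun z => by rw [phiR_conj, phiI_conj, mul_neg]
  have hre : ∀ p : SpherePairs (n + 1),
      ∫ z, (z p.1.1 * (starRingEnd ℂ) (z p.1.2)).re ^ 2 ∂μ = (n : ℝ) / (n + 1) / 2 := by
    intro p
    have h := hμ.two_mul_integral_re_sq hae p.2.ne
    rw [hμ.integral_normSq_mul hae, hB, if_neg p.2.ne] at h
    linarith
  have hRR : ∀ p q, ∫ z, phiR n p z * phiR n q z ∂μ = if p = q then 1 else 0 := by
    intro p q
    split_ifs with h
    · subst h
      simp_rw [phiR, mul_mul_mul_comm (LOd n), ← pow_two (Complex.re _)]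
      rw [integral_const_mul, hre, LOd_mul_self]
      field_simp
    · obtain ⟨k, hkp, hkq⟩ := SpherePairs.exists_mem_notMem h
      refine hμ.integral_eq_zero_of_neg_coord k
        ((continuous_phiR n p).mul (continuous_phiR n q)) fun z => ?_
      simp only [phiR, mul_conj_neg_coord_of_mem hkp, mul_conj_neg_coord_of_notMem hkq,
        Complex.neg_re]
      ring
  have hII : ∀ p q, ∫ z, phiI n p z * phiI n q z ∂μ = if p = q then 1 else 0 := by
    intro p q
    split_ifs with h
    · subst h
      simp_rw [phiI, mul_mul_mul_comm (LOd n), ← pow_two (Complex.im _)]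
      rw [integral_const_mul, hμ.integral_im_sq_eq p.2.ne, hre, LOd_mul_self]
      field_simp
    · obtain ⟨k, hkp, hkq⟩ := SpherePairs.exists_mem_notMem h
      refine hμ.integral_eq_zero_of_neg_coord k
        ((continuous_phiI n p).mul (continuous_phiI n q)) fun z => ?_
      simp only [phiI, mul_conj_neg_coord_of_mem hkp, mul_conj_neg_coord_of_notMem hkq,
        Complex.neg_im]
      ring
  rintro (α | p | p) (β | q | q)
  · simpa [fam] using hAA α β
  · simpa [fam] using hAR α q
  · simpa [fam] using hAI α q
  · simpa [fam, mul_comm] using hAR β p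
  · simpa [fam] using hRR p q
  · simpa [fam] using hRI p q
  · simpa [fam, mul_comm] using hAI β p
  · simpa [fam, mul_comm] using hRI q p
  · simpa [fam] using hII p q
end

section
/- For every z = (z_1, …, z_{n+1}) ∈ ℂ^{n+1}, Σ_{α=1}^{n} φ_α(z)² + Σ_{1 ≤ k < l ≤ n+1} ( φ_{kl}(z)² + φ_{k̄l̄}(z)² ) = ( Σ_{k=1}^{n+1} |z_k|² )². In particular, the map Φ(z) = (φ_α(z); φ_{kl}(z); φ_{k̄l̄}(z)) ∈ ℝ^{n(n+2)} sends the unit sphere S^{2n+1} ⊂ ℂ^{n+1} into the unit sphere S^{n(n+2)−1} ⊂ ℝ^{n(n+2)}. -/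
open scoped BigOperators

/-- The map `Φ : ℂ^{n+1} → ℝ^{n(n+2)}`. -/
noncomputable def PhiMap (n : ℕ) (z : Fin (n + 1) → ℂ) : EuclideanSpace ℝ (FamIdx n) :=
  (WithLp.equiv 2 (FamIdx n → ℝ)).symm (fun i => fam n i z)

/-- Helmert's decomposition of the sum of squared deviations from the mean. -/
theorem helmert_sum_sq (n : ℕ) (x : Fin (n + 1) → ℝ) :
    ∑ a : Fin n, ((n : ℝ) - a.val) / ((n : ℝ) + 1 - a.val) *
      (x a.castSucc - (1 / ((n : ℝ) - a.val)) *
        ∑ k : Fin (n + 1), if (a.val : ℕ) < k.val then x k else 0) ^ 2 =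
      ∑ k, x k ^ 2 - (∑ k, x k) ^ 2 / ((n : ℝ) + 1) := by
  induction n with
  | zero => simp
  | succ n ih =>
    have h := ih (fun k => x k.succ)
    have h₁ : (n : ℝ) + 1 ≠ 0 := by positivity
    have h₂ : (n : ℝ) + 1 + 1 ≠ 0 := by positivity
    rw [Fin.sum_univ_succ]
    have key : ∀ a : Fin n,
        (((n + 1 : ℕ) : ℝ) - a.succ.val) / (((n + 1 : ℕ) : ℝ) + 1 - a.succ.val) *
          (x a.succ.castSucc - (1 / (((n + 1 : ℕ) : ℝ) - a.succ.val)) *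
            ∑ k : Fin (n + 1 + 1), if (a.succ.val : ℕ) < k.val then x k else 0) ^ 2 =
        ((n : ℝ) - a.val) / ((n : ℝ) + 1 - a.val) *
          (x a.castSucc.succ - (1 / ((n : ℝ) - a.val)) *
            ∑ k : Fin (n + 1), if (a.val : ℕ) < k.val then x k.succ else 0) ^ 2 := by
      intro a
      have e₁ : ((n + 1 : ℕ) : ℝ) - a.succ.val = n - a.val := by
        push_cast [Fin.val_succ]; ring
      have e₂ : ((n + 1 : ℕ) : ℝ) + 1 - a.succ.val = n + 1 - a.val := by
        push_cast [Fin.val_succ]; ring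
      rw [e₁, e₂, Fin.sum_univ_succ]
      simp
    rw [Finset.sum_congr rfl fun a _ => key a, h, Fin.sum_univ_succ (fun k => x k ^ 2),
      Fin.sum_univ_succ x, Fin.sum_univ_succ]
    simp only [Fin.val_zero, Fin.val_succ, lt_irrefl, if_false, Nat.zero_lt_succ, if_true,
      Fin.castSucc_zero, Nat.cast_zero, sub_zero, zero_add]
    push_cast
    field_simp
    ring

theorem sum_sq_eq_sum_sq_add_two_mul_sum_lt (m : ℕ) (x : Fin m → ℝ) :
    (∑ k, x k) ^ 2 = ∑ k, x k ^ 2 + 2 * ∑ p : SpherePairs m, x p.1.1 * x p.1.2 := by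
  have h : ∑ p : SpherePairs m, x p.1.1 * x p.1.2 =
      ∑ i, ∑ j, if i < j then x i * x j else 0 := by
    rw [← Fintype.sum_prod_type' (fun i j => if i < j then x i * x j else 0),
      ← Finset.sum_filter]
    exact (Finset.sum_subtype _ (by simp) (fun p : Fin m × Fin m => x p.1 * x p.2)).symm
  rw [h]
  clear h
  induction m with
  | zero => simp
  | succ m ih =>
    have := ih (fun k => x k.succ)
    simp only [Fin.sum_univ_succ, Fin.succ_lt_succ_iff, Fin.succ_pos, if_true,
      if_false, Fin.not_lt_zero, zero_add, ← Finset.mul_sum]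
    linear_combination this

theorem sum_phi_sq (n : ℕ) (hn : 1 ≤ n) (z : Fin (n + 1) → ℂ) :
    (∑ α : Fin n, phiA n α z ^ 2) +
        (∑ p : SpherePairs (n + 1), (phiR n p z ^ 2 + phiI n p z ^ 2)) =
      (∑ k : Fin (n + 1), Complex.normSq (z k)) ^ 2 := by
  have hn₀ : (0 : ℝ) < n := by exact_mod_cast hn
  have hA : ∑ α : Fin n, phiA n α z ^ 2 = ((n : ℝ) + 1) / n *
      (∑ k, Complex.normSq (z k) ^ 2 - (∑ k, Complex.normSq (z k)) ^ 2 / ((n : ℝ) + 1)) := by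
    rw [← helmert_sum_sq n (fun k => Complex.normSq (z k)), Finset.mul_sum]
    refine Finset.sum_congr rfl fun a _ => ?_
    have ha : (a.val : ℝ) < n := by exact_mod_cast a.isLt
    have e₁ : (n : ℝ) + 1 - ((a.val + 1 : ℕ) : ℝ) = n - a.val := by push_cast; ring
    have e₂ : (n : ℝ) + 2 - ((a.val + 1 : ℕ) : ℝ) = n + 1 - a.val := by push_cast; ring
    have h₁ : (0 : ℝ) < n - a.val := by linarith
    have h₂ : (0 : ℝ) < n + 1 - a.val := by linarith
    rw [phiA, mul_pow, LOc, e₁, e₂, Real.sq_sqrt (by positivity), mul_div_mul_comm, mul_assoc]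
  have hP : ∑ p : SpherePairs (n + 1), (phiR n p z ^ 2 + phiI n p z ^ 2) =
      2 * ((n : ℝ) + 1) / n *
        ∑ p : SpherePairs (n + 1), Complex.normSq (z p.1.1) * Complex.normSq (z p.1.2) := by
    rw [Finset.mul_sum]
    refine Finset.sum_congr rfl fun p _ => ?_
    rw [phiR, phiI, mul_pow, mul_pow, ← mul_add, LOd, Real.sq_sqrt (by positivity),
      ← Complex.normSq_conj (z p.1.2), ← Complex.normSq_mul, Complex.normSq_apply, sq, sq]
  rw [hA, hP]
  have h := sum_sq_eq_sum_sq_add_two_mul_sum_lt (n + 1) (fun k => Complex.normSq (z k))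
  field_simp
  linear_combination (-((n : ℝ) + 1)) * h

/-- The sum of the squares of the `n(n+2)` functions equals
`(Σ |z_k|²)²`; in particular `Φ` maps the unit sphere `S^{2n+1}` into the unit
sphere `S^{n(n+2)-1}`. -/
theorem typeI_sum_of_squares (n : ℕ) (hn : 1 ≤ n) :
    (∀ z : Fin (n + 1) → ℂ,
      (∑ α : Fin n, phiA n α z ^ 2) +
        (∑ p : SpherePairs (n + 1), (phiR n p z ^ 2 + phiI n p z ^ 2)) =
      (∑ k : Fin (n + 1), Complex.normSq (z k)) ^ 2) ∧
    (∀ z : Fin (n + 1) → ℂ,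
      (∑ k : Fin (n + 1), Complex.normSq (z k)) = 1 → ‖PhiMap n z‖ = 1) := by
  refine ⟨sum_phi_sq n hn, fun z hz => ?_⟩
  have h := sum_phi_sq n hn z
  rw [hz, one_pow, Finset.sum_add_distrib] at h
  rw [EuclideanSpace.norm_eq, Real.sqrt_eq_one]
  simpa [PhiMap, fam, Fintype.sum_sum_type] using h
end

section
/- The type-I Lawson–Osserman map F : ℂ^{n+1} → ℝ^{(n+1)²+2n+1} defined by F(z) = ( a_n Re(z), a_n Im(z), b_n φ_α(z) (1 ≤ α ≤ n), b_n φ_{kl}(z), b_n φ_{k̄l̄}(z) (1 ≤ k < l ≤ n+1) ) sends the unit sphere S^{2n+1} ⊂ ℂ^{n+1} into the unit sphere S^{(n+1)²+2n} ⊂ ℝ^{(n+1)²+2n+1}: if Σ_{k=1}^{n+1} |z_k|² = 1 then the Euclidean norm of F(z) equals 1. -/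
open scoped BigOperators

/-- The constant `a_n`. -/
noncomputable def LOa (n : ℕ) : ℝ :=
  Real.sqrt (2 * ((n : ℝ) + 1) / ((2 * n + 1) * ((n : ℝ) + 2)))

/-- The constant `b_n`. -/
noncomputable def LOb (n : ℕ) : ℝ :=
  Real.sqrt ((n : ℝ) * (2 * n + 3) / ((2 * n + 1) * ((n : ℝ) + 2)))

/-- Index type for `ℝ^{(n+1)²+2n+1} = ℝ^{n+1} × ℝ^{n+1} × ℝ^{n(n+2)}`. -/
abbrev BIdx (n : ℕ) := Fin (n + 1) ⊕ Fin (n + 1) ⊕ FamIdx n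

/-- The type-I Lawson–Osserman map
`F(z) = (a_n Re z, a_n Im z, b_n φ_α(z), b_n φ_{kl}(z), b_n φ_{k̄l̄}(z))`. -/
noncomputable def LOF (n : ℕ) (z : Fin (n + 1) → ℂ) : EuclideanSpace ℝ (BIdx n) :=
  (WithLp.equiv 2 (BIdx n → ℝ)).symm fun i =>
    match i with
    | Sum.inl k => LOa n * (z k).re
    | Sum.inr (Sum.inl k) => LOa n * (z k).im
    | Sum.inr (Sum.inr j) => LOb n * fam n j z

/-- The Helmert decomposition of a sum of squares around the mean. -/
theorem sum_helmert_sq (n : ℕ) (x : Fin (n + 1) → ℝ) :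
    ∑ α : Fin n, ((n : ℝ) - α.val) / ((n : ℝ) - α.val + 1) *
      (x α.castSucc - (1 / ((n : ℝ) - α.val)) *
        ∑ k : Fin (n + 1), if α.val < k.val then x k else 0) ^ 2 =
      ∑ k, x k ^ 2 - (∑ k, x k) ^ 2 / ((n : ℝ) + 1) := by
  induction n with
  | zero => simp
  | succ n ih =>
    have key := ih fun k => x k.succ
    rw [Fin.sum_univ_succ, Fin.sum_univ_succ (fun k => x k ^ 2), Fin.sum_univ_succ x]
    have tail : ∀ α : Fin n,
        (∑ k : Fin (n + 1 + 1), if (α.succ).val < k.val then x k else 0) =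
          ∑ k : Fin (n + 1), if α.val < k.val then x k.succ else 0 := fun α => by
      rw [Fin.sum_univ_succ]
      simp
    have head : (∑ k : Fin (n + 1 + 1), if (0 : Fin (n + 1)).val < k.val then x k else 0) =
        ∑ k : Fin (n + 1), x k.succ := by
      rw [Fin.sum_univ_succ]
      simp
    have coeff : ∀ α : Fin n, ((n + 1 : ℕ) : ℝ) - (α.succ).val = (n : ℝ) - α.val :=
      fun α => by simp
    simp only [tail, coeff, head, ← Fin.succ_castSucc, key]
    have h1 : (n : ℝ) + 1 ≠ 0 := by positivity
    have h2 : (n : ℝ) + 1 + 1 ≠ 0 := by positivity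
    simp only [Fin.val_zero, Nat.cast_zero, sub_zero, Nat.cast_add, Nat.cast_one,
      Fin.castSucc_zero]
    field_simp
    ring

/-- Twice the second elementary symmetric sum is the square of the sum minus the sum of squares. -/
theorem two_mul_sum_spherePairs (m : ℕ) (x : Fin m → ℝ) :
    2 * ∑ p : SpherePairs m, x p.1.1 * x p.1.2 = (∑ k, x k) ^ 2 - ∑ k, x k ^ 2 := by
  have hpairs : ∑ p : SpherePairs m, x p.1.1 * x p.1.2 =
      ∑ i, ∑ j, if i < j then x i * x j else 0 := by
    rw [← Fintype.sum_prod_type' (f := fun i j => if i < j then x i * x j else 0),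
      ← Finset.sum_filter]
    exact (Finset.sum_subtype (Finset.univ.filter fun p : Fin m × Fin m => p.1 < p.2)
      (by simp) fun p => x p.1 * x p.2).symm
  have hswap : ∑ i, ∑ j, (if i < j then x i * x j else 0) =
      ∑ i, ∑ j, if j < i then x i * x j else 0 := by
    rw [Finset.sum_comm]
    simp only [mul_comm]
  have hdiag : ∑ i, x i ^ 2 = ∑ i, ∑ j, if i = j then x i * x j else 0 := by
    simp [sq]
  rw [hpairs, two_mul]
  nth_rewrite 2 [hswap]
  rw [eq_sub_iff_add_eq, hdiag, sq, Finset.sum_mul_sum]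
  simp only [← Finset.sum_add_distrib]
  refine Finset.sum_congr rfl fun i _ => Finset.sum_congr rfl fun j _ => ?_
  rcases lt_trichotomy i j with h | rfl | h
  · simp [h, h.ne, h.not_gt]
  · simp
  · simp [h, h.ne', h.not_gt]

theorem LOd_sq (n : ℕ) : LOd n ^ 2 = 2 * ((n : ℝ) + 1) / n :=
  Real.sq_sqrt (by positivity)

theorem LOa_sq_add_LOb_sq (n : ℕ) : LOa n ^ 2 + LOb n ^ 2 = 1 := by
  rw [LOa, LOb, Real.sq_sqrt (by positivity), Real.sq_sqrt (by positivity)]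
  field_simp
  ring

theorem LOc_sq (n : ℕ) (α : Fin n) :
    LOc n (α.val + 1) ^ 2 =
      ((n : ℝ) + 1) / n * (((n : ℝ) - α.val) / ((n : ℝ) - α.val + 1)) := by
  have h : (0 : ℝ) < (n : ℝ) - α.val := sub_pos.mpr (by exact_mod_cast α.isLt)
  have e1 : (n : ℝ) + 1 - ((α.val + 1 : ℕ) : ℝ) = n - α.val := by push_cast; ring
  have e2 : (n : ℝ) + 2 - ((α.val + 1 : ℕ) : ℝ) = n - α.val + 1 := by push_cast; ring
  rw [LOc, e1, e2, Real.sq_sqrt (by positivity), mul_div_mul_comm]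

/-- The sum of the squares of the family is the fourth power of the norm. -/
theorem sum_fam_sq (n : ℕ) (hn : 1 ≤ n) (z : Fin (n + 1) → ℂ) :
    ∑ j, fam n j z ^ 2 = (∑ k, Complex.normSq (z k)) ^ 2 := by
  have hn' : (n : ℝ) ≠ 0 := by positivity
  have hA : ∑ α, phiA n α z ^ 2 = ((n : ℝ) + 1) / n *
      (∑ k, Complex.normSq (z k) ^ 2 - (∑ k, Complex.normSq (z k)) ^ 2 / ((n : ℝ) + 1)) := by
    rw [← sum_helmert_sq, Finset.mul_sum]
    refine Finset.sum_congr rfl fun α _ => ?_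
    rw [phiA, mul_pow, LOc_sq, mul_assoc]
  have hP : ∑ p, phiR n p z ^ 2 + ∑ p, phiI n p z ^ 2 = ((n : ℝ) + 1) / n *
      ((∑ k, Complex.normSq (z k)) ^ 2 - ∑ k, Complex.normSq (z k) ^ 2) := by
    rw [← two_mul_sum_spherePairs, ← Finset.sum_add_distrib, ← mul_assoc, Finset.mul_sum]
    refine Finset.sum_congr rfl fun p _ => ?_
    rw [phiR, phiI, mul_pow, mul_pow, ← mul_add, LOd_sq, sq, sq, ← Complex.normSq_apply,
      map_mul, Complex.normSq_conj]
    ring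
  simp only [Fintype.sum_sum_type, fam]
  rw [hP, hA]
  field_simp
  ring

/-- The type-I Lawson–Osserman map `F` sends the unit sphere
`S^{2n+1} ⊂ ℂ^{n+1}` into the unit sphere `S^{(n+1)²+2n} ⊂ ℝ^{(n+1)²+2n+1}`. -/
theorem typeI_LO_sphere_to_sphere (n : ℕ) (hn : 1 ≤ n)
    (z : Fin (n + 1) → ℂ) (hz : ∑ k : Fin (n + 1), Complex.normSq (z k) = 1) :
    ‖LOF n z‖ = 1 := by
  rw [EuclideanSpace.norm_eq, Real.sqrt_eq_one]
  have hlin : ∑ k, (LOa n * (z k).re) ^ 2 + ∑ k, (LOa n * (z k).im) ^ 2 = LOa n ^ 2 := by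
    rw [← Finset.sum_add_distrib, ← mul_one (LOa n ^ 2), ← hz, Finset.mul_sum]
    refine Finset.sum_congr rfl fun k _ => ?_
    rw [Complex.normSq_apply]
    ring
  have hquad : ∑ j, (LOb n * fam n j z) ^ 2 = LOb n ^ 2 := by
    simp only [mul_pow]
    rw [← Finset.mul_sum, sum_fam_sq n hn, hz, one_pow, mul_one]
  simp only [Real.norm_eq_abs, sq_abs]
  rw [Fintype.sum_sum_type, Fintype.sum_sum_type, ← add_assoc]
  change ∑ k, (LOa n * (z k).re) ^ 2 + ∑ k, (LOa n * (z k).im) ^ 2 +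
    ∑ j, (LOb n * fam n j z) ^ 2 = 1
  rw [hlin, hquad, LOa_sq_add_LOb_sq]
end

section
/- For every z = (z_1, …, z_8) ∈ ℂ⁸, ( Σ_{k=1}^{4} |z_k|² − Σ_{k=5}^{8} |z_k|² )² + 4( |a_1|² + |a_2|² + |a_3|² + |a_4|² ) = ( Σ_{k=1}^{8} |z_k|² )², equivalently f_1² + Σ_{k=2}^{9} f_k² = ( Σ_{k=1}^{8} |z_k|² )². In particular the (octonionic Hopf) map z ↦ (f_1, f_2, …, f_9) sends the unit sphere S^{15} ⊂ ℂ⁸ into the unit sphere S⁸ ⊂ ℝ⁹. -/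
open scoped BigOperators

open Complex in
/-- The four complex quadratic polynomials `a₁, a₂, a₃, a₄` (components of
`2·conj(p₁)p₂` for octonions), as a function `Fin 4 → ℂ`; the eight complex
variables `z_1, …, z_8` are indexed by `Fin 8` (0-based). -/
noncomputable def octA (z : Fin 8 → ℂ) : Fin 4 → ℂ :=
  ![(starRingEnd ℂ) (z 0) * z 4 + z 1 * (starRingEnd ℂ) (z 5) +
      z 2 * (starRingEnd ℂ) (z 6) + (starRingEnd ℂ) (z 3) * z 7,
    (starRingEnd ℂ) (z 0) * z 5 - z 1 * (starRingEnd ℂ) (z 4) -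
      (starRingEnd ℂ) (z 2) * z 7 + z 3 * (starRingEnd ℂ) (z 6),
    (starRingEnd ℂ) (z 0) * z 6 + (starRingEnd ℂ) (z 1) * z 7 -
      z 2 * (starRingEnd ℂ) (z 4) - z 3 * (starRingEnd ℂ) (z 5),
    z 0 * z 7 - z 1 * z 6 + z 2 * z 5 - z 3 * z 4]

/-- `f₁ = Σ_{k=1}^4 |z_k|² − Σ_{k=5}^8 |z_k|²`. -/
noncomputable def octf1 (z : Fin 8 → ℂ) : ℝ :=
  (Complex.normSq (z 0) + Complex.normSq (z 1) + Complex.normSq (z 2) +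
      Complex.normSq (z 3)) -
    (Complex.normSq (z 4) + Complex.normSq (z 5) + Complex.normSq (z 6) +
      Complex.normSq (z 7))

/-- The nine real functions `(f₁, …, f₉)`, i.e. the (normalized) octonionic
Hopf map, as a point of `ℝ⁹`. -/
noncomputable def octHopf (z : Fin 8 → ℂ) : EuclideanSpace ℝ (Fin 9) :=
  (WithLp.equiv 2 (Fin 9 → ℝ)).symm
    ![octf1 z,
      2 * (octA z 0).re, 2 * (octA z 1).re, 2 * (octA z 2).re, 2 * (octA z 3).re,
      2 * (octA z 0).im, 2 * (octA z 1).im, 2 * (octA z 2).im, 2 * (octA z 3).im]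

/-- The norm of the octonions is multiplicative, written for the polynomials `octA`. -/
theorem sum_normSq_octA (z : Fin 8 → ℂ) :
    ∑ i : Fin 4, Complex.normSq (octA z i) =
      (Complex.normSq (z 0) + Complex.normSq (z 1) + Complex.normSq (z 2) +
          Complex.normSq (z 3)) *
        (Complex.normSq (z 4) + Complex.normSq (z 5) + Complex.normSq (z 6) +
          Complex.normSq (z 7)) := by
  simp only [Fin.sum_univ_four, octA, Matrix.cons_val, Complex.normSq_apply, Complex.add_re,
    Complex.add_im, Complex.sub_re, Complex.sub_im, Complex.mul_re, Complex.mul_im,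
    Complex.conj_re, Complex.conj_im]
  ring

theorem octf1_sq_add_sum_normSq_octA (z : Fin 8 → ℂ) :
    octf1 z ^ 2 + 4 * (∑ i : Fin 4, Complex.normSq (octA z i)) =
      (∑ k : Fin 8, Complex.normSq (z k)) ^ 2 := by
  rw [sum_normSq_octA, octf1, Fin.sum_univ_eight]
  ring

theorem norm_octHopf_sq (z : Fin 8 → ℂ) :
    ‖octHopf z‖ ^ 2 = octf1 z ^ 2 + 4 * ∑ i : Fin 4, Complex.normSq (octA z i) := by
  rw [EuclideanSpace.real_norm_sq_eq]
  simp only [octHopf, WithLp.equiv_symm_apply, Fin.sum_univ_succ, Fin.sum_univ_zero,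
    Complex.normSq_apply]
  simp
  ring

/-- For every `z ∈ ℂ⁸`,
`f₁² + 4(|a₁|² + |a₂|² + |a₃|² + |a₄|²) = (Σ |z_k|²)²`, equivalently
`f₁² + Σ_{k=2}^9 f_k² = (Σ |z_k|²)²`; in particular the octonionic Hopf map
`z ↦ (f₁, …, f₉)` sends `S^{15} ⊂ ℂ⁸` into `S⁸ ⊂ ℝ⁹`. -/
theorem octonionic_Hopf (z : Fin 8 → ℂ) :
    (octf1 z ^ 2 + 4 * (∑ i : Fin 4, Complex.normSq (octA z i)) =
      (∑ k : Fin 8, Complex.normSq (z k)) ^ 2) ∧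
    (octf1 z ^ 2 +
        (∑ i : Fin 4, ((2 * (octA z i).re) ^ 2 + (2 * (octA z i).im) ^ 2)) =
      (∑ k : Fin 8, Complex.normSq (z k)) ^ 2) ∧
    ((∑ k : Fin 8, Complex.normSq (z k)) = 1 → ‖octHopf z‖ = 1) := by
  have h := octf1_sq_add_sum_normSq_octA z
  refine ⟨h, ?_, fun hz => ?_⟩
  · rw [← h, Finset.mul_sum]
    congr 1
    refine Finset.sum_congr rfl fun i _ => ?_
    rw [Complex.normSq_apply]
    ring
  · have hsq : ‖octHopf z‖ ^ 2 = 1 := by rw [norm_octHopf_sq, h, hz, one_pow]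
    exact (pow_eq_one_iff_of_nonneg (norm_nonneg _) two_ne_zero).mp hsq
end

section
/- The n(n+2) type-I second-fundamental-form matrices are pairwise orthogonal with respect to the Frobenius inner product ⟨A, B⟩ = trace(Aᵀ B). More precisely: (i) the matrices A^{2n+2} and A^{4n+1+α} (2 ≤ α ≤ n) are diagonal, and any two distinct ones among them are Frobenius-orthogonal; (ii) every matrix of the remaining family { A^{2n+1+k}, A^{3n+1+k} (2 ≤ k ≤ n+1), A^{(k,l)}, A^{(k̄,l̄)} (2 ≤ k < l ≤ n+1) } has zero diagonal, and any two distinct matrices of this family have disjoint supports, i.e., their entrywise product is the zero matrix. -/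
open scoped BigOperators

/-- `q = a_n² + b_n² d_n²`. -/
noncomputable def LOq (n : ℕ) : ℝ := LOa n ^ 2 + LOb n ^ 2 * LOd n ^ 2

/-- `v = b_n d_n / q`. -/
noncomputable def LOv (n : ℕ) : ℝ := LOb n * LOd n / LOq n

/-- The symmetric matrix with entry `x` at positions `(i,j)` and `(j,i)` and
zeros elsewhere. -/
def symEntry {m : ℕ} (i j : Fin m) (x : ℝ) : Matrix (Fin m) (Fin m) ℝ :=
  fun a b => if (a = i ∧ b = j) ∨ (a = j ∧ b = i) then x else 0

/-- The matrix `A^{2n+2}`. -/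
noncomputable def MatA2n2 (n : ℕ) : Matrix (Fin (2 * n + 1)) (Fin (2 * n + 1)) ℝ :=
  Matrix.diagonal fun a =>
    if a.val = 0 then LOb n / LOa n
    else -(((n : ℝ) + 2) * LOa n * LOb n) / ((n : ℝ) * LOq n)

/-- The matrix `A^{2n+1+k}`, for `κ : Fin n` representing `k = κ + 2`:
entry `v` at position `(1, n+k)` (1-based), filled in symmetrically. -/
noncomputable def MatB (n : ℕ) (κ : Fin n) : Matrix (Fin (2 * n + 1)) (Fin (2 * n + 1)) ℝ :=
  symEntry ⟨0, by omega⟩ ⟨n + κ.val + 1, by have := κ.isLt; omega⟩ (LOv n)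

/-- The matrix `A^{3n+1+k}`, for `κ : Fin n` representing `k = κ + 2`:
entry `v` at position `(1, k)` (1-based), filled in symmetrically. -/
noncomputable def MatC (n : ℕ) (κ : Fin n) : Matrix (Fin (2 * n + 1)) (Fin (2 * n + 1)) ℝ :=
  symEntry ⟨0, by omega⟩ ⟨κ.val + 1, by have := κ.isLt; omega⟩ (LOv n)

/-- The matrix `A^{4n+1+α}`, for `β : Fin (n-1)` representing `α = β + 2`. -/
noncomputable def MatD (n : ℕ) (β : Fin (n - 1)) :
    Matrix (Fin (2 * n + 1)) (Fin (2 * n + 1)) ℝ :=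
  Matrix.diagonal fun a =>
    if a.val = β.val + 1 ∨ a.val = n + β.val + 1 then
      2 * LOb n * LOc n (β.val + 2) / LOq n
    else if (β.val + 2 ≤ a.val ∧ a.val ≤ n) ∨ n + β.val + 2 ≤ a.val then
      -(2 * LOb n * LOc n (β.val + 2)) / (((n : ℝ) - 1 - β.val) * LOq n)
    else 0

/-- The matrix `A^{(k,l)}`, for a pair `κ < λ` in `Fin n` representing
`k = κ + 2 < l = λ + 2`: entries `v` at positions `(k,l)` and `(n+k,n+l)`
(1-based), filled in symmetrically. -/
noncomputable def MatE (n : ℕ) (p : SpherePairs n) :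
    Matrix (Fin (2 * n + 1)) (Fin (2 * n + 1)) ℝ :=
  symEntry ⟨p.1.1.val + 1, by have := p.1.1.isLt; omega⟩
      ⟨p.1.2.val + 1, by have := p.1.2.isLt; omega⟩ (LOv n) +
    symEntry ⟨n + p.1.1.val + 1, by have := p.1.1.isLt; omega⟩
      ⟨n + p.1.2.val + 1, by have := p.1.2.isLt; omega⟩ (LOv n)

/-- The matrix `A^{(k̄,l̄)}`: entry `v` at `(k, n+l)` and entry `−v` at
`(l, n+k)` (1-based), filled in symmetrically. -/
noncomputable def MatF (n : ℕ) (p : SpherePairs n) :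
    Matrix (Fin (2 * n + 1)) (Fin (2 * n + 1)) ℝ :=
  symEntry ⟨p.1.1.val + 1, by have := p.1.1.isLt; omega⟩
      ⟨n + p.1.2.val + 1, by have := p.1.2.isLt; omega⟩ (LOv n) +
    symEntry ⟨p.1.2.val + 1, by have := p.1.2.isLt; omega⟩
      ⟨n + p.1.1.val + 1, by have := p.1.1.isLt; omega⟩ (-(LOv n))

/-- Indices of the two diagonal subfamilies: `A^{2n+2}` and `A^{4n+1+α}`
(`2 ≤ α ≤ n`). -/
abbrev DiagIdx (n : ℕ) := Unit ⊕ Fin (n - 1)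

/-- Indices of the off-diagonal subfamilies: `A^{2n+1+k}`, `A^{3n+1+k}`
(`2 ≤ k ≤ n+1`), `A^{(k,l)}`, `A^{(k̄,l̄)}` (`2 ≤ k < l ≤ n+1`). -/
abbrev OffIdx (n : ℕ) := Fin n ⊕ Fin n ⊕ SpherePairs n ⊕ SpherePairs n

/-- Indices of the full family of `n(n+2)` type-I second-fundamental-form
matrices. -/
abbrev TypeIIdx (n : ℕ) := DiagIdx n ⊕ OffIdx n

/-- The full family of type-I second-fundamental-form matrices. -/
noncomputable def Amat (n : ℕ) : TypeIIdx n → Matrix (Fin (2 * n + 1)) (Fin (2 * n + 1)) ℝ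
  | Sum.inl (Sum.inl _) => MatA2n2 n
  | Sum.inl (Sum.inr β) => MatD n β
  | Sum.inr (Sum.inl κ) => MatB n κ
  | Sum.inr (Sum.inr (Sum.inl κ)) => MatC n κ
  | Sum.inr (Sum.inr (Sum.inr (Sum.inl p))) => MatE n p
  | Sum.inr (Sum.inr (Sum.inr (Sum.inr p))) => MatF n p

/-- The weights `x` at `k`, `y` above `k` and `0` below `k` have total
`x + (n - 1 - k) y` over `range n`. -/
theorem sum_range_step (n k : ℕ) (hk : k < n) (x y : ℝ) :
    ∑ i ∈ Finset.range n, (if i = k then x else if k < i then y else 0) =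
      x + ((n : ℝ) - 1 - k) * y := by
  obtain ⟨m, rfl⟩ : ∃ m, n = k + 1 + m := ⟨n - (k + 1), by omega⟩
  rw [Finset.sum_range_add, Finset.sum_range_succ, Finset.sum_eq_zero, Finset.sum_congr rfl
    (g := fun _ => y)]
  · rw [Finset.sum_const, Finset.card_range, nsmul_eq_mul, if_pos rfl]
    push_cast
    ring
  · intro i _
    rw [if_neg (by omega), if_pos (by omega)]
  · intro i hi
    have := Finset.mem_range.1 hi
    rw [if_neg (by omega), if_neg (by omega)]

theorem trace_MatD (n : ℕ) (β : Fin (n - 1)) : ∑ a, MatD n β a a = 0 := by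
  have hβ := β.isLt
  have hne : (n : ℝ) - 1 - β.val ≠ 0 := by
    have : ((β.val + 1 : ℕ) : ℝ) < n := by exact_mod_cast (by omega : β.val + 1 < n)
    push_cast at this
    linarith
  simp only [MatD, Matrix.diagonal_apply_eq]
  set x := 2 * LOb n * LOc n (β.val + 2) / LOq n with hx
  set y := -(2 * LOb n * LOc n (β.val + 2)) / (((n : ℝ) - 1 - β.val) * LOq n) with hy
  have hxy : x + ((n : ℝ) - 1 - β.val) * y = 0 := by
    rw [hx, hy, ← mul_div_assoc, mul_div_mul_left _ _ hne, neg_div, add_neg_cancel]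
  have hs := sum_range_step n β.val (by omega) x y
  rw [Fin.sum_univ_eq_sum_range (fun a => if a = β.val + 1 ∨ a = n + β.val + 1 then x
    else if (β.val + 2 ≤ a ∧ a ≤ n) ∨ n + β.val + 2 ≤ a then y else 0), Finset.sum_range_succ',
    two_mul, Finset.sum_range_add, if_neg (by omega), if_neg (by omega), add_zero]
  have h₁ : ∀ i ∈ Finset.range n, (if i + 1 = β.val + 1 ∨ i + 1 = n + β.val + 1 then x
      else if (β.val + 2 ≤ i + 1 ∧ i + 1 ≤ n) ∨ n + β.val + 2 ≤ i + 1 then y else 0) =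
      if i = β.val then x else if β.val < i then y else 0 := by
    intro i hi
    have := Finset.mem_range.1 hi
    congr 1
    · exact propext (by omega)
    · congr 1
      exact propext (by omega)
  have h₂ : ∀ i ∈ Finset.range n, (if n + i + 1 = β.val + 1 ∨ n + i + 1 = n + β.val + 1 then x
      else if (β.val + 2 ≤ n + i + 1 ∧ n + i + 1 ≤ n) ∨ n + β.val + 2 ≤ n + i + 1 then y
      else 0) = if i = β.val then x else if β.val < i then y else 0 := by
    intro i hi
    congr 1
    · exact propext (by omega)
    · congr 1
      exact propext (by omega)
  rw [Finset.sum_congr rfl h₁, Finset.sum_congr rfl h₂, hs, hxy, add_zero]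

/-- On the support of `MatD n β`, the matrix `MatA2n2 n` is scalar. -/
theorem MatA2n2_mul_MatD (n : ℕ) (β : Fin (n - 1)) :
    ∑ a, MatA2n2 n a a * MatD n β a a = 0 := by
  rw [Finset.sum_congr rfl (g := fun a =>
    -(((n : ℝ) + 2) * LOa n * LOb n) / ((n : ℝ) * LOq n) * MatD n β a a), ← Finset.mul_sum,
    trace_MatD, mul_zero]
  intro a _
  by_cases ha : a.val = 0
  · have : MatD n β a a = 0 := by
      simp only [MatD, Matrix.diagonal_apply_eq]
      rw [if_neg (by omega), if_neg (by omega)]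
    simp [this]
  · rw [MatA2n2, Matrix.diagonal_apply_eq, if_neg ha]

/-- On the support of `MatD n γ`, the matrix `MatD n β` with `β < γ` is scalar. -/
theorem MatD_mul_MatD_of_lt (n : ℕ) {β γ : Fin (n - 1)} (h : β < γ) :
    ∑ a, MatD n β a a * MatD n γ a a = 0 := by
  have h' : β.val < γ.val := h
  rw [Finset.sum_congr rfl (g := fun a => -(2 * LOb n * LOc n (β.val + 2)) /
    (((n : ℝ) - 1 - β.val) * LOq n) * MatD n γ a a), ← Finset.mul_sum, trace_MatD, mul_zero]
  intro a _
  by_cases ha : (γ.val + 1 ≤ a.val ∧ a.val ≤ n) ∨ n + γ.val + 1 ≤ a.val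
  · congr 1
    simp only [MatD, Matrix.diagonal_apply_eq]
    rw [if_neg (by omega), if_pos (by omega)]
  · have : MatD n γ a a = 0 := by
      simp only [MatD, Matrix.diagonal_apply_eq]
      rw [if_neg (by omega), if_neg (by omega)]
    simp [this]

theorem Amat_inl_apply_ne (n : ℕ) (ν : DiagIdx n) {a b : Fin (2 * n + 1)} (h : a ≠ b) :
    Amat n (Sum.inl ν) a b = 0 := by
  rcases ν with _ | β
  · exact Matrix.diagonal_apply_ne _ h
  · exact Matrix.diagonal_apply_ne _ h

theorem sum_Amat_inl_mul (n : ℕ) {ν μ : DiagIdx n} (h : ν ≠ μ) :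
    ∑ a, Amat n (Sum.inl ν) a a * Amat n (Sum.inl μ) a a = 0 := by
  rcases ν with _ | β <;> rcases μ with _ | γ
  · exact absurd rfl h
  · exact MatA2n2_mul_MatD n γ
  · exact (Finset.sum_congr rfl fun _ _ => mul_comm _ _).trans (MatA2n2_mul_MatD n β)
  · rcases lt_or_gt_of_ne (fun e => h (congrArg Sum.inr e) : β ≠ γ) with hlt | hlt
    · exact MatD_mul_MatD_of_lt n hlt
    · exact (Finset.sum_congr rfl fun _ _ => mul_comm _ _).trans (MatD_mul_MatD_of_lt n hlt)

/-- The (0-based) positions at which an off-diagonal matrix may be nonzero. -/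
def offSupport (n : ℕ) : OffIdx n → ℕ → ℕ → Prop
  | Sum.inl κ, a, b => a = 0 ∧ b = n + κ + 1
  | Sum.inr (Sum.inl κ), a, b => a = 0 ∧ b = κ + 1
  | Sum.inr (Sum.inr (Sum.inl p)), a, b =>
      (a = p.1.1 + 1 ∧ b = p.1.2 + 1) ∨ (a = n + p.1.1 + 1 ∧ b = n + p.1.2 + 1)
  | Sum.inr (Sum.inr (Sum.inr p)), a, b =>
      (a = p.1.1 + 1 ∧ b = n + p.1.2 + 1) ∨ (a = p.1.2 + 1 ∧ b = n + p.1.1 + 1)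

theorem offSupport_lt (n : ℕ) (ν : OffIdx n) {a b : ℕ} (h : offSupport n ν a b) : a < b := by
  rcases ν with κ | κ | p | p
  all_goals
    simp only [offSupport] at h
    omega

theorem offSupport_injective (n : ℕ) {ν μ : OffIdx n} {a b : ℕ} (hν : offSupport n ν a b)
    (hμ : offSupport n μ a b) : ν = μ := by
  rcases ν with κ | κ | p | p <;> rcases μ with κ' | κ' | p' | p' <;>
    simp only [offSupport, Sum.inl.injEq, Sum.inr.injEq, Subtype.ext_iff, Prod.ext_iff,
      Fin.ext_iff, reduceCtorEq] at hν hμ ⊢ <;>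
    omega

theorem symEntry_apply_ne_zero {m : ℕ} {i j a b : Fin m} {x : ℝ} (h : symEntry i j x a b ≠ 0) :
    (a.val = i.val ∧ b.val = j.val) ∨ (b.val = i.val ∧ a.val = j.val) := by
  by_contra hc
  refine h (if_neg fun hab => hc ?_)
  simpa only [Fin.ext_iff, and_comm] using hab

theorem Amat_inr_apply_ne_zero (n : ℕ) (ν : OffIdx n) {a b : Fin (2 * n + 1)}
    (h : Amat n (Sum.inr ν) a b ≠ 0) : offSupport n ν a b ∨ offSupport n ν b a := by
  have split : ∀ {x y : ℝ}, x + y ≠ 0 → x ≠ 0 ∨ y ≠ 0 := fun hxy => by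
    by_contra! hc
    exact hxy (by simp [hc])
  rcases ν with κ | κ | p | p
  · exact symEntry_apply_ne_zero h
  · exact symEntry_apply_ne_zero h
  all_goals
    rcases split h with h | h <;> rcases symEntry_apply_ne_zero h with h | h
    · exact .inl (.inl h)
    · exact .inr (.inl h)
    · exact .inl (.inr h)
    · exact .inr (.inr h)

theorem Amat_inr_apply_self (n : ℕ) (ν : OffIdx n) (a : Fin (2 * n + 1)) :
    Amat n (Sum.inr ν) a a = 0 := by
  by_contra h
  rcases Amat_inr_apply_ne_zero n ν h with h | h <;> exact lt_irrefl _ (offSupport_lt n ν h)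

theorem Amat_inr_mul_apply (n : ℕ) {ν μ : OffIdx n} (h : ν ≠ μ) (a b : Fin (2 * n + 1)) :
    Amat n (Sum.inr ν) a b * Amat n (Sum.inr μ) a b = 0 := by
  by_contra hc
  obtain ⟨hν, hμ⟩ := mul_ne_zero_iff.1 hc
  rcases Amat_inr_apply_ne_zero n ν hν with hν | hν <;>
    rcases Amat_inr_apply_ne_zero n μ hμ with hμ | hμ
  · exact h (offSupport_injective n hν hμ)
  · exact lt_asymm (offSupport_lt n ν hν) (offSupport_lt n μ hμ)
  · exact lt_asymm (offSupport_lt n ν hν) (offSupport_lt n μ hμ)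
  · exact h (offSupport_injective n hν hμ)

theorem trace_transpose_mul_eq_sum {m : Type*} [Fintype m] (A B : Matrix m m ℝ) :
    (A.transpose * B).trace = ∑ b, ∑ a, A a b * B a b := rfl

theorem trace_transpose_mul_Amat (n : ℕ) {ν μ : TypeIIdx n} (h : ν ≠ μ) :
    ((Amat n ν).transpose * Amat n μ).trace = 0 := by
  rw [trace_transpose_mul_eq_sum]
  rcases ν with ν | ν <;> rcases μ with μ | μ
  · rw [← sum_Amat_inl_mul n (ν := ν) (μ := μ) fun e => h (congrArg Sum.inl e)]
    refine Finset.sum_congr rfl fun b _ => Finset.sum_eq_single b (fun a _ hab => ?_) (by simp)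
    rw [Amat_inl_apply_ne n ν hab, zero_mul]
  · refine Finset.sum_eq_zero fun b _ => Finset.sum_eq_zero fun a _ => ?_
    rcases eq_or_ne a b with rfl | hab
    · rw [Amat_inr_apply_self, mul_zero]
    · rw [Amat_inl_apply_ne n ν hab, zero_mul]
  · refine Finset.sum_eq_zero fun b _ => Finset.sum_eq_zero fun a _ => ?_
    rcases eq_or_ne a b with rfl | hab
    · rw [Amat_inr_apply_self, zero_mul]
    · rw [Amat_inl_apply_ne n μ hab, mul_zero]
  · exact Finset.sum_eq_zero fun b _ => Finset.sum_eq_zero fun a _ =>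
      Amat_inr_mul_apply n (fun e => h (congrArg Sum.inr e)) a b

open Matrix in
/-- The `n(n+2)` type-I second-fundamental-form matrices are
pairwise Frobenius-orthogonal; more precisely the matrices of the diagonal
family are diagonal and pairwise orthogonal, and the matrices of the remaining
family have zero diagonal and pairwise disjoint supports. -/
theorem typeI_matrices_orthogonal (n : ℕ) (hn : 1 ≤ n) :
    (∀ ν μ : TypeIIdx n, ν ≠ μ → ((Amat n ν)ᵀ * Amat n μ).trace = 0) ∧
    (∀ ν : DiagIdx n, ∀ a b, a ≠ b → Amat n (Sum.inl ν) a b = 0) ∧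
    (∀ ν μ : DiagIdx n, ν ≠ μ →
      ((Amat n (Sum.inl ν))ᵀ * Amat n (Sum.inl μ)).trace = 0) ∧
    (∀ ν : OffIdx n, ∀ a, Amat n (Sum.inr ν) a a = 0) ∧
    (∀ ν μ : OffIdx n, ν ≠ μ → ∀ a b,
      Amat n (Sum.inr ν) a b * Amat n (Sum.inr μ) a b = 0) := by
  exact ⟨fun _ _ h => trace_transpose_mul_Amat n h, fun ν _ _ h => Amat_inl_apply_ne n ν h,
    fun _ _ h => trace_transpose_mul_Amat n fun e => h (Sum.inl.inj e),
    fun ν a => Amat_inr_apply_self n ν a, fun _ _ h a b => Amat_inr_mul_apply n h a b⟩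
end

section
/- (The maximal squared norm 𝒮² of the second fundamental form of the type-I Lawson–Osserman sphere.) Let I be the index set of the n(n+2) type-I second-fundamental-form matrices. For every real family (λ_ν)_{ν ∈ I} with Σ_{ν ∈ I} λ_ν² = 1, the squared Frobenius norm of Σ_{ν ∈ I} λ_ν A^ν satisfies ‖ Σ_ν λ_ν A^ν ‖² ≤ (2n+1)(2n+3)/(4(n+1)), with equality if and only if λ_{2n+2} = ±1 and all other λ_ν = 0. Moreover (2n+1)(2n+3)/(4(n+1)) < n+1, i.e., 𝒮² is strictly less than half the dimension 2n+2 of the cone C F. -/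
open scoped BigOperators

/-- The Frobenius inner product of two real matrices. -/
def frobInner {m : ℕ} (A B : Matrix (Fin m) (Fin m) ℝ) : ℝ := ∑ a, ∑ b, A a b * B a b

lemma frobInner_comm {m : ℕ} (A B : Matrix (Fin m) (Fin m) ℝ) :
    frobInner A B = frobInner B A := by
  simp only [frobInner, mul_comm]

lemma frobInner_add_left {m : ℕ} (A B C : Matrix (Fin m) (Fin m) ℝ) :
    frobInner (A + B) C = frobInner A C + frobInner B C := by
  simp only [frobInner, Matrix.add_apply, add_mul, Finset.sum_add_distrib]

lemma frobInner_add_right {m : ℕ} (A B C : Matrix (Fin m) (Fin m) ℝ) :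
    frobInner A (B + C) = frobInner A B + frobInner A C := by
  simp only [frobInner, Matrix.add_apply, mul_add, Finset.sum_add_distrib]

lemma frobInner_diagonal {m : ℕ} (f g : Fin m → ℝ) :
    frobInner (Matrix.diagonal f) (Matrix.diagonal g) = ∑ a, f a * g a := by
  simp [frobInner, Matrix.diagonal_apply]

lemma frobInner_symEntry {m : ℕ} {i j : Fin m} (hij : i ≠ j) (x : ℝ)
    (M : Matrix (Fin m) (Fin m) ℝ) :
    frobInner (symEntry i j x) M = x * (M i j + M j i) := by
  have entry : ∀ a b : Fin m, symEntry i j x a b * M a b =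
      (if a = i then if b = j then x * M a b else 0 else 0) +
        (if a = j then if b = i then x * M a b else 0 else 0) := by
    intro a b
    unfold symEntry
    split_ifs <;> grind
  simp only [frobInner, entry, Finset.sum_add_distrib]
  simp [Finset.sum_ite_irrel, mul_add]

lemma frobInner_symEntry_self {m : ℕ} {i j : Fin m} (hij : i ≠ j) (x : ℝ) :
    frobInner (symEntry i j x) (symEntry i j x) = 2 * x ^ 2 := by
  rw [frobInner_symEntry hij]
  simp [symEntry]
  ring

lemma frobInner_symEntry_of_ne {m : ℕ} {i j k l : Fin m}
    (h : i ≠ j ∧ ¬(i = k ∧ j = l) ∧ ¬(i = l ∧ j = k)) (x y : ℝ) :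
    frobInner (symEntry i j x) (symEntry k l y) = 0 := by
  obtain ⟨hij, h₁, h₂⟩ := h
  rw [frobInner_symEntry hij]
  unfold symEntry
  rw [if_neg (by tauto), if_neg (by tauto)]
  simp

lemma frobInner_symEntry_diagonal {m : ℕ} {i j : Fin m} (hij : i ≠ j) (x : ℝ)
    (f : Fin m → ℝ) : frobInner (symEntry i j x) (Matrix.diagonal f) = 0 := by
  rw [frobInner_symEntry hij, Matrix.diagonal_apply_ne _ hij, Matrix.diagonal_apply_ne _ hij.symm]
  simp

lemma frobInner_linearCombination_left {m : ℕ} {ι : Type*} [Fintype ι]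
    (A : ι → Matrix (Fin m) (Fin m) ℝ) (c : ι → ℝ) (B : Matrix (Fin m) (Fin m) ℝ) :
    frobInner (∑ ν, c ν • A ν) B = ∑ ν, c ν * frobInner (A ν) B := by
  simp only [frobInner, Finset.mul_sum, Matrix.sum_apply, Matrix.smul_apply, smul_eq_mul,
    Finset.sum_mul, mul_assoc]
  exact Finset.sum_comm_cycle

lemma frobInner_linearCombination_self {m : ℕ} {ι : Type*} [Fintype ι]
    {A : ι → Matrix (Fin m) (Fin m) ℝ} (h : ∀ μ ν, μ ≠ ν → frobInner (A μ) (A ν) = 0)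
    (c : ι → ℝ) :
    frobInner (∑ ν, c ν • A ν) (∑ ν, c ν • A ν) = ∑ ν, c ν ^ 2 * frobInner (A ν) (A ν) := by
  rw [frobInner_linearCombination_left]
  refine Finset.sum_congr rfl fun μ _ => ?_
  rw [frobInner_comm, frobInner_linearCombination_left,
    Finset.sum_eq_single μ (fun ν _ hν => by rw [h ν μ hν, mul_zero]) (by simp)]
  ring

/-- The function on `ℕ` that is `0` before `β`, `x` at `β` and `y` after `β`. -/
def stepFun (β : ℕ) (x y : ℝ) (i : ℕ) : ℝ := if i = β then x else if β < i then y else 0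

lemma sum_stepFun {n β : ℕ} (h : β < n) (x y : ℝ) :
    ∑ i ∈ Finset.range n, stepFun β x y i = x + ((n : ℝ) - 1 - β) * y := by
  induction n, h using Nat.le_induction with
  | base =>
    rw [Finset.sum_range_succ, Finset.sum_eq_zero]
    · simp [stepFun]
    · intro i hi
      have := Finset.mem_range.1 hi
      simp [stepFun, this.ne, this.not_gt]
  | succ m hm ih =>
    have : β < m := hm
    rw [Finset.sum_range_succ, ih]
    simp only [stepFun, this, this.ne', if_false, if_true]
    push_cast
    ring

lemma sum_fin_two_mul_add_one (n : ℕ) (F : ℕ → ℝ) :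
    ∑ a : Fin (2 * n + 1), F a.val =
      F 0 + ∑ i ∈ Finset.range n, (F (i + 1) + F (n + i + 1)) := by
  rw [Fin.sum_univ_eq_sum_range F, Finset.sum_range_succ', two_mul, Finset.sum_range_add,
    Finset.sum_add_distrib]
  ring

/-- The diagonal of `MatA2n2`. -/
noncomputable def diagA (n i : ℕ) : ℝ :=
  if i = 0 then LOb n / LOa n else -(((n : ℝ) + 2) * LOa n * LOb n) / ((n : ℝ) * LOq n)

/-- The step function repeated twice on the diagonal of `MatD`. -/
noncomputable def diagD (n β : ℕ) : ℕ → ℝ :=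
  stepFun β (2 * LOb n * LOc n (β + 2) / LOq n)
    (-(2 * LOb n * LOc n (β + 2)) / (((n : ℝ) - 1 - β) * LOq n))

lemma sum_diagD {n β : ℕ} (h : β < n - 1) : ∑ i ∈ Finset.range n, diagD n β i = 0 := by
  have hn : (0 : ℝ) < (n : ℝ) - 1 - β := by
    have : ((β + 1 : ℕ) : ℝ) < n := by exact_mod_cast (by omega)
    push_cast at this
    linarith
  rw [diagD, sum_stepFun (by omega), neg_div, mul_neg, ← mul_div_assoc,
    mul_div_mul_left _ _ hn.ne']
  ring

lemma sum_diagD_mul {n β γ : ℕ} (h : β < γ) (hγ : γ < n - 1) :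
    ∑ i ∈ Finset.range n, diagD n β i * diagD n γ i = 0 := by
  have const : ∀ i, diagD n β i * diagD n γ i =
      (-(2 * LOb n * LOc n (β + 2)) / (((n : ℝ) - 1 - β) * LOq n)) * diagD n γ i := by
    intro i
    unfold diagD stepFun
    split_ifs <;> first | omega | simp
  simp only [const, ← Finset.mul_sum, sum_diagD hγ, mul_zero]

lemma MatA2n2_eq (n : ℕ) : MatA2n2 n = Matrix.diagonal fun a => diagA n a.val := rfl

lemma MatD_eq {n : ℕ} (β : Fin (n - 1)) :
    MatD n β = Matrix.diagonal fun a =>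
      if a.val = 0 then 0 else if a.val ≤ n then diagD n β (a.val - 1)
        else diagD n β (a.val - 1 - n) := by
  unfold MatD
  congr 1
  funext a
  have := β.isLt
  have := a.isLt
  unfold diagD stepFun
  split_ifs <;> first | rfl | omega

lemma frobInner_diagonal_MatD {n : ℕ} (β : Fin (n - 1)) (F : ℕ → ℝ) :
    frobInner (Matrix.diagonal fun a => F a.val) (MatD n β) =
      ∑ i ∈ Finset.range n, (F (i + 1) + F (n + i + 1)) * diagD n β i := by
  rw [MatD_eq, frobInner_diagonal,
    sum_fin_two_mul_add_one n fun i => F i * (if i = 0 then 0 else if i ≤ n then diagD n β (i - 1)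
        else diagD n β (i - 1 - n))]
  simp only [if_true, mul_zero, zero_add]
  refine Finset.sum_congr rfl fun i hi => ?_
  have := Finset.mem_range.1 hi
  rw [if_neg (by omega), if_pos (by omega), if_neg (by omega), if_neg (by omega),
    show n + i + 1 - 1 - n = i by omega, Nat.add_sub_cancel]
  ring

lemma frobInner_MatD_MatD {n : ℕ} (β γ : Fin (n - 1)) :
    frobInner (MatD n β) (MatD n γ) =
      2 * ∑ i ∈ Finset.range n, diagD n β i * diagD n γ i := by
  rw [MatD_eq β, frobInner_diagonal_MatD γ fun i => if i = 0 then 0 else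
    if i ≤ n then diagD n β (i - 1) else diagD n β (i - 1 - n), Finset.mul_sum]
  refine Finset.sum_congr rfl fun i hi => ?_
  have := Finset.mem_range.1 hi
  rw [if_neg (by omega), if_pos (by omega), if_neg (by omega), if_neg (by omega),
    show n + i + 1 - 1 - n = i by omega, Nat.add_sub_cancel]
  ring

lemma frobInner_MatA2n2_MatD {n : ℕ} (β : Fin (n - 1)) :
    frobInner (MatA2n2 n) (MatD n β) = 0 := by
  rw [MatA2n2_eq, frobInner_diagonal_MatD]
  simp [diagA, ← Finset.mul_sum, sum_diagD β.isLt]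

lemma frobInner_offDiag {n : ℕ} (o : OffIdx n) (ν : TypeIIdx n) (h : Sum.inr o ≠ ν) :
    frobInner (Amat n (Sum.inr o)) (Amat n ν) = 0 := by
  rcases o with κ | κ | ⟨⟨k, l⟩, (hkl : k.val < l.val)⟩ | ⟨⟨k, l⟩, (hkl : k.val < l.val)⟩ <;>
  rcases ν with (u | β) | κ' | κ' | ⟨⟨k', l'⟩, (hkl' : k'.val < l'.val)⟩ |
    ⟨⟨k', l'⟩, (hkl' : k'.val < l'.val)⟩ <;>
  simp [Fin.ext_iff] at h <;>
  simp (disch := (simp only [ne_eq, Fin.ext_iff]; omega)) only [Amat, MatB, MatC, MatE, MatF,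
    MatA2n2, MatD, frobInner_add_left, frobInner_add_right, frobInner_symEntry_of_ne,
    frobInner_symEntry_diagonal, add_zero]

lemma frobInner_Amat_of_ne {n : ℕ} {μ ν : TypeIIdx n} (h : μ ≠ ν) :
    frobInner (Amat n μ) (Amat n ν) = 0 := by
  rcases μ with (u | β) | o
  · rcases ν with (u' | γ) | o
    · exact absurd rfl h
    · exact frobInner_MatA2n2_MatD γ
    · rw [frobInner_comm, frobInner_offDiag o _ h.symm]
  · rcases ν with (u | γ) | o
    · rw [frobInner_comm]
      exact frobInner_MatA2n2_MatD β
    · simp only [Amat, frobInner_MatD_MatD]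
      rcases lt_trichotomy β.val γ.val with hlt | heq | hlt
      · rw [sum_diagD_mul hlt γ.isLt, mul_zero]
      · exact absurd (by rw [Fin.ext heq]) h
      · simp only [mul_comm (diagD n β _)]
        rw [sum_diagD_mul hlt β.isLt, mul_zero]
    · rw [frobInner_comm, frobInner_offDiag o _ h.symm]
  · exact frobInner_offDiag o ν h

lemma LOq_eq {n : ℕ} (hn : 1 ≤ n) : LOq n = 4 * ((n : ℝ) + 1) / (2 * n + 1) := by
  have : (0 : ℝ) < n := by exact_mod_cast hn
  rw [LOq, LOa, LOb, LOd, Real.sq_sqrt (by positivity), Real.sq_sqrt (by positivity),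
    Real.sq_sqrt (by positivity)]
  field_simp
  ring

lemma LOv_sq {n : ℕ} (hn : 1 ≤ n) :
    LOv n ^ 2 = (2 * (n : ℝ) + 1) * (2 * n + 3) / (8 * ((n : ℝ) + 1) * (n + 2)) := by
  have : (0 : ℝ) < n := by exact_mod_cast hn
  rw [LOv, div_pow, mul_pow, LOq_eq hn, LOb, LOd, Real.sq_sqrt (by positivity),
    Real.sq_sqrt (by positivity)]
  field_simp
  ring

lemma frobInner_MatA2n2_self {n : ℕ} (hn : 1 ≤ n) :
    frobInner (MatA2n2 n) (MatA2n2 n) =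
      (2 * (n : ℝ) + 1) * (2 * n + 3) / (4 * ((n : ℝ) + 1)) := by
  have : (0 : ℝ) < n := by exact_mod_cast hn
  rw [MatA2n2_eq, frobInner_diagonal, sum_fin_two_mul_add_one n fun i => diagA n i * diagA n i]
  simp only [diagA, ← sq, if_true, Nat.add_one_ne_zero, if_false, Finset.sum_const,
    Finset.card_range, nsmul_eq_mul, div_pow, neg_sq, mul_pow]
  rw [LOq_eq hn, LOa, LOb, Real.sq_sqrt (by positivity), Real.sq_sqrt (by positivity)]
  field_simp
  ring

lemma frobInner_MatD_self {n : ℕ} (hn : 1 ≤ n) (β : Fin (n - 1)) :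
    frobInner (MatD n β) (MatD n β) = 4 * LOv n ^ 2 := by
  have : (0 : ℝ) < n := by exact_mod_cast hn
  have hβ : (0 : ℝ) < (n : ℝ) - 1 - β := by
    have : ((β + 1 : ℕ) : ℝ) < n := by exact_mod_cast (by have := β.isLt; omega)
    push_cast at this
    linarith
  have square : ∀ i, diagD n β i * diagD n β i =
      stepFun β ((2 * LOb n * LOc n (β + 2) / LOq n) ^ 2)
        ((-(2 * LOb n * LOc n (β + 2)) / (((n : ℝ) - 1 - β) * LOq n)) ^ 2) i := by
    intro i
    unfold diagD stepFun
    split_ifs <;> ring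
  have hc : LOc n (β + 2) ^ 2 =
      ((n : ℝ) + 1) * ((n : ℝ) - 1 - β) / (n * ((n : ℝ) - 1 - β + 1)) := by
    rw [LOc, Real.sq_sqrt]
    · push_cast
      congr 2 <;> ring
    · push_cast
      rw [show (n : ℝ) + 1 - (β + 2) = n - 1 - β by ring,
        show (n : ℝ) + 2 - (β + 2) = n - 1 - β + 1 by ring]
      positivity
  simp only [frobInner_MatD_MatD, square]
  rw [sum_stepFun (by have := β.isLt; omega), LOv_sq hn, div_pow, div_pow, neg_sq, mul_pow,
    mul_pow, mul_pow, hc, LOq_eq hn, LOb, Real.sq_sqrt (by positivity)]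
  generalize (n : ℝ) - 1 - β = t at hβ
  field_simp
  ring

lemma frobInner_offDiag_self_le {n : ℕ} (o : OffIdx n) :
    frobInner (Amat n (Sum.inr o)) (Amat n (Sum.inr o)) ≤ 4 * LOv n ^ 2 := by
  rcases o with κ | κ | ⟨⟨k, l⟩, (hkl : k.val < l.val)⟩ | ⟨⟨k, l⟩, (hkl : k.val < l.val)⟩ <;>
  simp (disch := (simp only [ne_eq, Fin.ext_iff]; omega)) only [Amat, MatB, MatC, MatE, MatF,
    frobInner_add_left, frobInner_add_right, frobInner_symEntry_of_ne,
    frobInner_symEntry_self] <;>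
  nlinarith [sq_nonneg (LOv n)]

lemma frobInner_Amat_self_lt {n : ℕ} (hn : 1 ≤ n) {ν : TypeIIdx n}
    (h : ν ≠ Sum.inl (Sum.inl ())) :
    frobInner (Amat n ν) (Amat n ν) <
      (2 * (n : ℝ) + 1) * (2 * n + 3) / (4 * ((n : ℝ) + 1)) := by
  have : (0 : ℝ) < n := by exact_mod_cast hn
  have hv : 4 * LOv n ^ 2 < (2 * (n : ℝ) + 1) * (2 * n + 3) / (4 * ((n : ℝ) + 1)) := by
    rw [LOv_sq hn, ← sub_pos]
    have : (2 * (n : ℝ) + 1) * (2 * n + 3) / (4 * ((n : ℝ) + 1)) -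
        4 * ((2 * (n : ℝ) + 1) * (2 * n + 3) / (8 * ((n : ℝ) + 1) * (n + 2))) =
        n * (2 * (n : ℝ) + 1) * (2 * n + 3) / (4 * ((n : ℝ) + 1) * (n + 2)) := by
      field_simp
      ring
    rw [this]
    positivity
  rcases ν with (u | β) | o
  · exact absurd rfl h
  · exact (frobInner_MatD_self hn β).trans_lt hv
  · exact (frobInner_offDiag_self_le o).trans_lt hv

/-- A weighted sum of squares with total mass one is at most its largest weight, and attains it
only at the unit vectors supported where the weight is largest. -/
lemma weighted_sum_sq_le {ι : Type*} [Fintype ι] {w : ι → ℝ} {i₀ : ι}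
    (hw : ∀ i, i ≠ i₀ → w i < w i₀) (c : ι → ℝ) (hc : ∑ i, c i ^ 2 = 1) :
    ∑ i, c i ^ 2 * w i ≤ w i₀ ∧
      (∑ i, c i ^ 2 * w i = w i₀ ↔ (c i₀ = 1 ∨ c i₀ = -1) ∧ ∀ i, i ≠ i₀ → c i = 0) := by
  classical
  have hle : ∀ i, 0 ≤ c i ^ 2 * (w i₀ - w i) := fun i => by
    by_cases h : i = i₀
    · simp [h]
    · exact mul_nonneg (sq_nonneg _) (sub_nonneg.2 (hw i h).le)
  have gap : w i₀ - ∑ i, c i ^ 2 * w i = ∑ i, c i ^ 2 * (w i₀ - w i) := by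
    simp only [mul_sub, Finset.sum_sub_distrib, ← Finset.sum_mul, hc, one_mul]
  have hpos := Finset.sum_nonneg fun i (_ : i ∈ Finset.univ) => hle i
  refine ⟨by linarith, fun h => ?_, fun ⟨h₀, h⟩ => ?_⟩
  · have hzero := (Finset.sum_eq_zero_iff_of_nonneg fun i _ => hle i).1
      (gap.symm.trans (sub_eq_zero.2 h.symm))
    have hvanish : ∀ i, i ≠ i₀ → c i = 0 := fun i hi => by
      have := hzero i (Finset.mem_univ i)
      simpa [(sub_pos.2 (hw i hi)).ne'] using this
    refine ⟨?_, hvanish⟩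
    rw [Finset.sum_eq_single i₀ (fun i _ hi => by simp [hvanish i hi]) (by simp)] at hc
    exact sq_eq_one_iff.1 hc
  · rw [Finset.sum_eq_single i₀ (fun i _ hi => by simp [h i hi]) (by simp),
      sq_eq_one_iff.2 h₀, one_mul]

/-- Among unit combinations of the `n(n+2)` type-I
second-fundamental-form matrices, the squared Frobenius norm is at most
`(2n+1)(2n+3)/(4(n+1))`, with equality exactly for `±A^{2n+2}`; moreover this
maximum `𝒮²` is strictly less than `n+1`, half the dimension of the cone. -/
theorem typeI_S_squared (n : ℕ) (hn : 1 ≤ n) :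
    (∀ lam : TypeIIdx n → ℝ, (∑ ν, lam ν ^ 2) = 1 →
      ((∑ a, ∑ b, ((∑ ν, lam ν • Amat n ν) a b) ^ 2) ≤
          (2 * (n : ℝ) + 1) * (2 * n + 3) / (4 * ((n : ℝ) + 1)) ∧
        ((∑ a, ∑ b, ((∑ ν, lam ν • Amat n ν) a b) ^ 2) =
            (2 * (n : ℝ) + 1) * (2 * n + 3) / (4 * ((n : ℝ) + 1)) ↔
          ((lam (Sum.inl (Sum.inl ())) = 1 ∨ lam (Sum.inl (Sum.inl ())) = -1) ∧
            ∀ ν : TypeIIdx n, ν ≠ Sum.inl (Sum.inl ()) → lam ν = 0)))) ∧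
    (2 * (n : ℝ) + 1) * (2 * n + 3) / (4 * ((n : ℝ) + 1)) < (n : ℝ) + 1 := by
  refine ⟨fun lam hlam => ?_, ?_⟩
  · have expand : ∑ a, ∑ b, ((∑ ν, lam ν • Amat n ν) a b) ^ 2 =
        ∑ ν, lam ν ^ 2 * frobInner (Amat n ν) (Amat n ν) := by
      rw [← frobInner_linearCombination_self (fun _ _ => frobInner_Amat_of_ne) lam]
      simp only [frobInner, sq]
    rw [expand, ← frobInner_MatA2n2_self hn]
    refine weighted_sum_sq_le (w := fun ν => frobInner (Amat n ν) (Amat n ν))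
      (i₀ := Sum.inl (Sum.inl ())) (fun ν hν => ?_) lam hlam
    exact (frobInner_Amat_self_lt hn hν).trans_eq (frobInner_MatA2n2_self hn).symm
  · rw [div_lt_iff₀ (by positivity)]
    nlinarith
end
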